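/- Fix n ≥ 1 and 0 ≤ k ≤ n. The center of the Ozsváth–Szabó algebra ℬ_l(n,k) is isomorphic, as a commutative ring, to ℤ[U_1,…,U_n]/(U_{i_1}U_{i_2}⋯U_{i_{k+1}} : 1 ≤ i_1 < i_2 < ⋯ < i_{k+1} ≤ n), via the ring homomorphism sending the class of U_i to the central element of ℬ_l(n,k) given by the sum over all vertices x of the loop U_i at x. The same statement holds for ℬ_r(n,k). -/

import Mathlib

open scoped BigOperators

/-! ## Sign sequences encoded by boolean sequences (`true ↦ +1`, `false ↦ −1`) -/

/-- The sign value of a boolean: `true ↦ 1`, `false ↦ -1`. -/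
def bsgn (b : Bool) : ℤ := if b then 1 else -1

/-- The number of sign changes of a sign sequence of length `m + 1`. -/
def varCountB {m : ℕ} (β : Fin (m + 1) → Bool) : ℕ :=
  (Finset.univ.filter fun i : Fin m => β i.castSucc ≠ β i.succ).card

/-- `var_l(α) := var(+1, α_1, …, α_n)`. -/
def varLB {n : ℕ} (α : Fin n → Bool) : ℕ := varCountB (Fin.cons true α)

/-- `var_r(α) := var(α_1, …, α_n, (−1)^k)`. -/
def varRB {n : ℕ} (k : ℕ) (α : Fin n → Bool) : ℕ :=
  varCountB (Fin.snoc α (decide (k % 2 = 0)))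

/-- Two sign sequences differ in exactly one entry. -/
def DifferInOneEntry {n : ℕ} (α β : Fin n → Bool) : Prop :=
  ∃ i, α i ≠ β i ∧ ∀ j, j ≠ i → α j = β j

/-! ## Generators for the Ozsváth–Szabó algebras -/

/-- Generators of the Ozsváth–Szabó algebra: idempotents `I x` at vertices `x` (sets of `k`
dots), arrows `R i x` and `L i x` (labelled by `i`, with recorded source vertex `x`), and
loops `U i x`.  Invalid generators are set to zero by the relations. -/
inductive OSGen (n : ℕ) : Type
  | I : Finset (Fin n) → OSGen n
  | R : Fin n → Finset (Fin n) → OSGen n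
  | L : Fin n → Finset (Fin n) → OSGen n
  | U : Fin n → Finset (Fin n) → OSGen n

/-- Generators of the deformed hypertoric convolution algebra `B̃`: idempotents `e α` at
sign sequences `α` and arrows `p α β`.  Invalid generators are set to zero by the
relations. -/
inductive TGen (n : ℕ) : Type
  | e : (Fin n → Bool) → TGen n
  | p : (Fin n → Bool) → (Fin n → Bool) → TGen n

/-- The canonical generator `g` inside the free `ℤ`-algebra on `OSGen n`. -/
abbrev og {n : ℕ} (g : OSGen n) : FreeAlgebra ℤ (OSGen n) := FreeAlgebra.ι ℤ g

/-! ## The Ozsváth–Szabó algebra `ℬ_l(n,k)` -/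

/-- Validity of the arrow `R_i : x → y` in `ℬ_l(n,k)`: in `0`-based coordinates, label
`ℓ = i − 1` moves a dot from position `ℓ` to position `ℓ + 1` (so the paper's label `i`
satisfies `1 ≤ i ≤ n − 1`, `i − 1 ∈ x`, `i ∉ x`). -/
def ValidRL (n k : ℕ) (ℓ : Fin n) (x : Finset (Fin n)) : Prop :=
  x.card = k ∧ ∃ h : (ℓ : ℕ) + 1 < n, ℓ ∈ x ∧ (⟨(ℓ : ℕ) + 1, h⟩ : Fin n) ∉ x

/-- The target `y = (x ∖ {i−1}) ∪ {i}` of the arrow `R_i : x → y` in `ℬ_l(n,k)`. -/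
def moveRL (n : ℕ) (ℓ : Fin n) (x : Finset (Fin n)) : Finset (Fin n) :=
  if h : (ℓ : ℕ) + 1 < n then insert (⟨(ℓ : ℕ) + 1, h⟩ : Fin n) (x.erase ℓ) else x

/-- Validity of the arrow `L_i : y → x` in `ℬ_l(n,k)` (with recorded source `y`). -/
def ValidLL (n k : ℕ) (ℓ : Fin n) (y : Finset (Fin n)) : Prop :=
  y.card = k ∧ ∃ h : (ℓ : ℕ) + 1 < n, (⟨(ℓ : ℕ) + 1, h⟩ : Fin n) ∈ y ∧ ℓ ∉ y

/-- The target `x = (y ∖ {i}) ∪ {i−1}` of the arrow `L_i : y → x` in `ℬ_l(n,k)`. -/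
def moveLL (n : ℕ) (ℓ : Fin n) (y : Finset (Fin n)) : Finset (Fin n) :=
  if h : (ℓ : ℕ) + 1 < n then insert ℓ (y.erase (⟨(ℓ : ℕ) + 1, h⟩ : Fin n)) else y

/-- The total element `U_j`: the sum of all the `U_j` loops over the vertices. -/
noncomputable def totUL (n k : ℕ) (j : Fin n) : FreeAlgebra ℤ (OSGen n) :=
  ∑ x ∈ Finset.univ.filter (fun x : Finset (Fin n) => x.card = k), og (OSGen.U j x)

open OSGen in
/-- The defining relations of the Ozsváth–Szabó algebra `ℬ_l(n,k)`: the path algebra of the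
quiver with vertex set `V_l(n,k)` (the `k`-element subsets of `{0,…,n−1}`), arrows `R_i, L_i`
and loops `U_i`, modulo the relations (1)–(5). -/
inductive OSRelL (n k : ℕ) : FreeAlgebra ℤ (OSGen n) → FreeAlgebra ℤ (OSGen n) → Prop
  /- path algebra structure -/
  | idem_mul (x y : Finset (Fin n)) :
      OSRelL n k (og (I x) * og (I y)) (if x = y then og (I x) else 0)
  | idem_sum :
      OSRelL n k (∑ x ∈ Finset.univ.filter (fun x : Finset (Fin n) => x.card = k), og (I x)) 1
  | idem_junk (x : Finset (Fin n)) (h : x.card ≠ k) : OSRelL n k (og (I x)) 0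
  | R_junk (ℓ : Fin n) (x : Finset (Fin n)) (h : ¬ ValidRL n k ℓ x) : OSRelL n k (og (R ℓ x)) 0
  | L_junk (ℓ : Fin n) (y : Finset (Fin n)) (h : ¬ ValidLL n k ℓ y) : OSRelL n k (og (L ℓ y)) 0
  | U_junk (ℓ : Fin n) (x : Finset (Fin n)) (h : x.card ≠ k) : OSRelL n k (og (U ℓ x)) 0
  | R_src (ℓ : Fin n) (x : Finset (Fin n)) :
      OSRelL n k (og (I x) * og (R ℓ x)) (og (R ℓ x))
  | R_tgt (ℓ : Fin n) (x : Finset (Fin n)) :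
      OSRelL n k (og (R ℓ x) * og (I (moveRL n ℓ x))) (og (R ℓ x))
  | L_src (ℓ : Fin n) (y : Finset (Fin n)) :
      OSRelL n k (og (I y) * og (L ℓ y)) (og (L ℓ y))
  | L_tgt (ℓ : Fin n) (y : Finset (Fin n)) :
      OSRelL n k (og (L ℓ y) * og (I (moveLL n ℓ y))) (og (L ℓ y))
  | U_src (ℓ : Fin n) (x : Finset (Fin n)) :
      OSRelL n k (og (I x) * og (U ℓ x)) (og (U ℓ x))
  | U_tgt (ℓ : Fin n) (x : Finset (Fin n)) :
      OSRelL n k (og (U ℓ x) * og (I x)) (og (U ℓ x))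
  /- (1) the total element `U_j` commutes with every `R_i`, `L_i`, `U_i` -/
  | U_comm_R (j ℓ : Fin n) (x : Finset (Fin n)) :
      OSRelL n k (totUL n k j * og (R ℓ x)) (og (R ℓ x) * totUL n k j)
  | U_comm_L (j ℓ : Fin n) (y : Finset (Fin n)) :
      OSRelL n k (totUL n k j * og (L ℓ y)) (og (L ℓ y) * totUL n k j)
  | U_comm_U (j ℓ : Fin n) (x : Finset (Fin n)) :
      OSRelL n k (totUL n k j * og (U ℓ x)) (og (U ℓ x) * totUL n k j)
  /- (2) `R_i L_i = U_i I_x` and `L_i R_i = U_i I_y` for each arrow `R_i : x → y` -/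
  | RL_eq_U (ℓ : Fin n) (x : Finset (Fin n)) (h : ValidRL n k ℓ x) :
      OSRelL n k (og (R ℓ x) * og (L ℓ (moveRL n ℓ x))) (og (U ℓ x))
  | LR_eq_U (ℓ : Fin n) (x : Finset (Fin n)) (h : ValidRL n k ℓ x) :
      OSRelL n k (og (L ℓ (moveRL n ℓ x)) * og (R ℓ x)) (og (U ℓ (moveRL n ℓ x)))
  /- (3) distant commutation relations, `|i − j| > 1` -/
  | RR_comm (ℓ ℓ' : Fin n) (x : Finset (Fin n))
      (hd : (ℓ : ℕ) + 1 < (ℓ' : ℕ) ∨ (ℓ' : ℕ) + 1 < (ℓ : ℕ))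
      (h1 : ValidRL n k ℓ x) (h2 : ValidRL n k ℓ' (moveRL n ℓ x)) :
      OSRelL n k (og (R ℓ x) * og (R ℓ' (moveRL n ℓ x)))
        (og (R ℓ' x) * og (R ℓ (moveRL n ℓ' x)))
  | LL_comm (ℓ ℓ' : Fin n) (y : Finset (Fin n))
      (hd : (ℓ : ℕ) + 1 < (ℓ' : ℕ) ∨ (ℓ' : ℕ) + 1 < (ℓ : ℕ))
      (h1 : ValidLL n k ℓ y) (h2 : ValidLL n k ℓ' (moveLL n ℓ y)) :
      OSRelL n k (og (L ℓ y) * og (L ℓ' (moveLL n ℓ y)))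
        (og (L ℓ' y) * og (L ℓ (moveLL n ℓ' y)))
  | LR_comm (ℓ ℓ' : Fin n) (y : Finset (Fin n))
      (hd : (ℓ : ℕ) + 1 < (ℓ' : ℕ) ∨ (ℓ' : ℕ) + 1 < (ℓ : ℕ))
      (h1 : ValidLL n k ℓ y) (h2 : ValidRL n k ℓ' (moveLL n ℓ y)) :
      OSRelL n k (og (L ℓ y) * og (R ℓ' (moveLL n ℓ y)))
        (og (R ℓ' y) * og (L ℓ (moveRL n ℓ' y)))
  /- (4) `R_{i−1} R_i = 0` and `L_i L_{i−1} = 0` -/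
  | RR_zero (ℓ ℓ' : Fin n) (x : Finset (Fin n)) (h : (ℓ' : ℕ) = (ℓ : ℕ) + 1) :
      OSRelL n k (og (R ℓ x) * og (R ℓ' (moveRL n ℓ x))) 0
  | LL_zero (ℓ ℓ' : Fin n) (y : Finset (Fin n)) (h : (ℓ : ℕ) = (ℓ' : ℕ) + 1) :
      OSRelL n k (og (L ℓ y) * og (L ℓ' (moveLL n ℓ y))) 0
  /- (5) `U_i I_x = 0` whenever `x ∩ {i−1, i} = ∅` -/
  | U_vanish (ℓ : Fin n) (x : Finset (Fin n)) (h1 : ℓ ∉ x)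
      (h2 : ∀ h : (ℓ : ℕ) + 1 < n, (⟨(ℓ : ℕ) + 1, h⟩ : Fin n) ∉ x) :
      OSRelL n k (og (U ℓ x)) 0

/-- The Ozsváth–Szabó algebra `ℬ_l(n,k)`. -/
abbrev OSAlgL (n k : ℕ) := RingQuot (OSRelL n k)



/-- The predecessor of an index (with `prevFin 0 = 0`; only used when `1 ≤ ℓ`). -/
def prevFin {n : ℕ} (ℓ : Fin n) : Fin n :=
  ⟨(ℓ : ℕ) - 1, Nat.lt_of_le_of_lt (Nat.sub_le _ _) ℓ.isLt⟩

/-! ## The Ozsváth–Szabó algebra `ℬ_r(n,k)` -/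

/-- Validity of the arrow `R_i : x → y` in `ℬ_r(n,k)`: in our coordinates a vertex
`x : Finset (Fin n)` stands for the `k`-element subset `{j+1 : j ∈ x}` of `{1,…,n}`, and the
label `ℓ : Fin n` stands for the paper's label `i = ℓ + 1 ∈ {2,…,n}`; the arrow moves a dot
from position `ℓ − 1` to position `ℓ` (i.e. from `i − 1` to `i`). -/
def ValidRR (n k : ℕ) (ℓ : Fin n) (x : Finset (Fin n)) : Prop :=
  x.card = k ∧ 1 ≤ (ℓ : ℕ) ∧ prevFin ℓ ∈ x ∧ ℓ ∉ x

/-- The target `y = (x ∖ {i−1}) ∪ {i}` of the arrow `R_i : x → y` in `ℬ_r(n,k)`. -/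
def moveRR (n : ℕ) (ℓ : Fin n) (x : Finset (Fin n)) : Finset (Fin n) :=
  insert ℓ (x.erase (prevFin ℓ))

/-- Validity of the arrow `L_i : y → x` in `ℬ_r(n,k)` (with recorded source `y`). -/
def ValidLR (n k : ℕ) (ℓ : Fin n) (y : Finset (Fin n)) : Prop :=
  y.card = k ∧ 1 ≤ (ℓ : ℕ) ∧ ℓ ∈ y ∧ prevFin ℓ ∉ y

/-- The target `x = (y ∖ {i}) ∪ {i−1}` of the arrow `L_i : y → x` in `ℬ_r(n,k)`. -/
def moveLR (n : ℕ) (ℓ : Fin n) (y : Finset (Fin n)) : Finset (Fin n) :=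
  insert (prevFin ℓ) (y.erase ℓ)

/-- The total element `U_j`: the sum of all the `U_j` loops over the vertices. -/
noncomputable def totUR (n k : ℕ) (j : Fin n) : FreeAlgebra ℤ (OSGen n) :=
  ∑ x ∈ Finset.univ.filter (fun x : Finset (Fin n) => x.card = k), og (OSGen.U j x)

open OSGen in
/-- The defining relations of the Ozsváth–Szabó algebra `ℬ_r(n,k)`: the path algebra of the
quiver with vertex set `V_r(n,k)` (the `k`-element subsets of `{1,…,n}`), arrows `R_i, L_i`
(`2 ≤ i ≤ n`) and loops `U_i`, modulo the relations (1)–(5). -/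
inductive OSRelR (n k : ℕ) : FreeAlgebra ℤ (OSGen n) → FreeAlgebra ℤ (OSGen n) → Prop
  /- path algebra structure -/
  | idem_mul (x y : Finset (Fin n)) :
      OSRelR n k (og (I x) * og (I y)) (if x = y then og (I x) else 0)
  | idem_sum :
      OSRelR n k (∑ x ∈ Finset.univ.filter (fun x : Finset (Fin n) => x.card = k), og (I x)) 1
  | idem_junk (x : Finset (Fin n)) (h : x.card ≠ k) : OSRelR n k (og (I x)) 0
  | R_junk (ℓ : Fin n) (x : Finset (Fin n)) (h : ¬ ValidRR n k ℓ x) : OSRelR n k (og (R ℓ x)) 0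
  | L_junk (ℓ : Fin n) (y : Finset (Fin n)) (h : ¬ ValidLR n k ℓ y) : OSRelR n k (og (L ℓ y)) 0
  | U_junk (ℓ : Fin n) (x : Finset (Fin n)) (h : x.card ≠ k) : OSRelR n k (og (U ℓ x)) 0
  | R_src (ℓ : Fin n) (x : Finset (Fin n)) :
      OSRelR n k (og (I x) * og (R ℓ x)) (og (R ℓ x))
  | R_tgt (ℓ : Fin n) (x : Finset (Fin n)) :
      OSRelR n k (og (R ℓ x) * og (I (moveRR n ℓ x))) (og (R ℓ x))
  | L_src (ℓ : Fin n) (y : Finset (Fin n)) :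
      OSRelR n k (og (I y) * og (L ℓ y)) (og (L ℓ y))
  | L_tgt (ℓ : Fin n) (y : Finset (Fin n)) :
      OSRelR n k (og (L ℓ y) * og (I (moveLR n ℓ y))) (og (L ℓ y))
  | U_src (ℓ : Fin n) (x : Finset (Fin n)) :
      OSRelR n k (og (I x) * og (U ℓ x)) (og (U ℓ x))
  | U_tgt (ℓ : Fin n) (x : Finset (Fin n)) :
      OSRelR n k (og (U ℓ x) * og (I x)) (og (U ℓ x))
  /- (1) the total element `U_j` commutes with every `R_i`, `L_i`, `U_i` -/
  | U_comm_R (j ℓ : Fin n) (x : Finset (Fin n)) :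
      OSRelR n k (totUR n k j * og (R ℓ x)) (og (R ℓ x) * totUR n k j)
  | U_comm_L (j ℓ : Fin n) (y : Finset (Fin n)) :
      OSRelR n k (totUR n k j * og (L ℓ y)) (og (L ℓ y) * totUR n k j)
  | U_comm_U (j ℓ : Fin n) (x : Finset (Fin n)) :
      OSRelR n k (totUR n k j * og (U ℓ x)) (og (U ℓ x) * totUR n k j)
  /- (2) `R_i L_i = U_i I_x` and `L_i R_i = U_i I_y` for each arrow `R_i : x → y` -/
  | RL_eq_U (ℓ : Fin n) (x : Finset (Fin n)) (h : ValidRR n k ℓ x) :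
      OSRelR n k (og (R ℓ x) * og (L ℓ (moveRR n ℓ x))) (og (U ℓ x))
  | LR_eq_U (ℓ : Fin n) (x : Finset (Fin n)) (h : ValidRR n k ℓ x) :
      OSRelR n k (og (L ℓ (moveRR n ℓ x)) * og (R ℓ x)) (og (U ℓ (moveRR n ℓ x)))
  /- (3) distant commutation relations, `|i − j| > 1` -/
  | RR_comm (ℓ ℓ' : Fin n) (x : Finset (Fin n))
      (hd : (ℓ : ℕ) + 1 < (ℓ' : ℕ) ∨ (ℓ' : ℕ) + 1 < (ℓ : ℕ))
      (h1 : ValidRR n k ℓ x) (h2 : ValidRR n k ℓ' (moveRR n ℓ x)) :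
      OSRelR n k (og (R ℓ x) * og (R ℓ' (moveRR n ℓ x)))
        (og (R ℓ' x) * og (R ℓ (moveRR n ℓ' x)))
  | LL_comm (ℓ ℓ' : Fin n) (y : Finset (Fin n))
      (hd : (ℓ : ℕ) + 1 < (ℓ' : ℕ) ∨ (ℓ' : ℕ) + 1 < (ℓ : ℕ))
      (h1 : ValidLR n k ℓ y) (h2 : ValidLR n k ℓ' (moveLR n ℓ y)) :
      OSRelR n k (og (L ℓ y) * og (L ℓ' (moveLR n ℓ y)))
        (og (L ℓ' y) * og (L ℓ (moveLR n ℓ' y)))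
  | LR_comm (ℓ ℓ' : Fin n) (y : Finset (Fin n))
      (hd : (ℓ : ℕ) + 1 < (ℓ' : ℕ) ∨ (ℓ' : ℕ) + 1 < (ℓ : ℕ))
      (h1 : ValidLR n k ℓ y) (h2 : ValidRR n k ℓ' (moveLR n ℓ y)) :
      OSRelR n k (og (L ℓ y) * og (R ℓ' (moveLR n ℓ y)))
        (og (R ℓ' y) * og (L ℓ (moveRR n ℓ' y)))
  /- (4) `R_{i−1} R_i = 0` and `L_i L_{i−1} = 0` -/
  | RR_zero (ℓ ℓ' : Fin n) (x : Finset (Fin n)) (h : (ℓ' : ℕ) = (ℓ : ℕ) + 1) :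
      OSRelR n k (og (R ℓ x) * og (R ℓ' (moveRR n ℓ x))) 0
  | LL_zero (ℓ ℓ' : Fin n) (y : Finset (Fin n)) (h : (ℓ : ℕ) = (ℓ' : ℕ) + 1) :
      OSRelR n k (og (L ℓ y) * og (L ℓ' (moveLR n ℓ y))) 0
  /- (5) `U_i I_x = 0` whenever `x ∩ {i−1, i} = ∅` -/
  | U_vanish (ℓ : Fin n) (x : Finset (Fin n)) (h1 : ℓ ∉ x)
      (h2 : 1 ≤ (ℓ : ℕ) → prevFin ℓ ∉ x) :
      OSRelR n k (og (U ℓ x)) 0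

/-- The Ozsváth–Szabó algebra `ℬ_r(n,k)`. -/
abbrev OSAlgR (n k : ℕ) := RingQuot (OSRelR n k)


/-- The ideal of `ℤ[U_1,…,U_n]` generated by the squarefree monomials
`U_{i_1} ⋯ U_{i_{k+1}}` of degree `k + 1`. -/
noncomputable def squarefreeIdeal (n k : ℕ) : Ideal (MvPolynomial (Fin n) ℤ) :=
  Ideal.span {m | ∃ S : Finset (Fin n), S.card = k + 1 ∧ m = ∏ i ∈ S, MvPolynomial.X i}

namespace OzsvathSzabo

/-! ### Dot configurations in terms of their holes -/

section Configurations

variable {n k : ℕ}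

/-- Position `q` carries no dot of `x`; positions `q ≥ n` are always holes. -/
def Hole (x : Finset (Fin n)) (q : ℕ) : Prop := ∀ h : q < n, (⟨q, h⟩ : Fin n) ∉ x

lemma hole_val {x : Finset (Fin n)} {i : Fin n} : Hole x i ↔ i ∉ x :=
  ⟨fun h => h i.isLt, fun h _ => h⟩

lemma hole_of_le {x : Finset (Fin n)} {q : ℕ} (h : n ≤ q) : Hole x q :=
  fun h' => absurd h' (by omega)

lemma ext_hole {x y : Finset (Fin n)} (h : ∀ q, Hole x q ↔ Hole y q) : x = y := by
  ext i
  have := h i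
  rw [hole_val, hole_val] at this
  tauto

lemma validRL_iff {ℓ : Fin n} {x : Finset (Fin n)} :
    ValidRL n k ℓ x ↔ x.card = k ∧ (ℓ : ℕ) + 1 < n ∧ ¬ Hole x ℓ ∧ Hole x (ℓ + 1) := by
  rw [hole_val, not_not]
  exact ⟨fun ⟨h, h1, h2, h3⟩ => ⟨h, h1, h2, fun _ => h3⟩,
    fun ⟨h, h1, h2, h3⟩ => ⟨h, h1, h2, h3 h1⟩⟩

lemma validLL_iff {ℓ : Fin n} {x : Finset (Fin n)} :
    ValidLL n k ℓ x ↔ x.card = k ∧ (ℓ : ℕ) + 1 < n ∧ Hole x ℓ ∧ ¬ Hole x (ℓ + 1) := by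
  rw [hole_val]
  exact ⟨fun ⟨h, h1, h2, h3⟩ => ⟨h, h1, h3, fun h => h h1 h2⟩,
    fun ⟨h, h1, h2, h3⟩ => ⟨h, h1, by by_contra h4; exact h3 fun _ => h4, h2⟩⟩

lemma hole_moveRL {ℓ : Fin n} {x : Finset (Fin n)} (h : (ℓ : ℕ) + 1 < n) (q : ℕ) :
    Hole (moveRL n ℓ x) q ↔ q ≠ ℓ + 1 ∧ (q = ℓ ∨ Hole x q) := by
  rw [moveRL, dif_pos h]
  by_cases hq : q < n
  · simp only [Hole, hq, forall_true_left, Finset.mem_insert, Finset.mem_erase, Fin.ext_iff, ne_eq]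
    tauto
  · have h1 : q ≠ ℓ + 1 := by omega
    exact ⟨fun _ => ⟨h1, Or.inr (hole_of_le (by omega))⟩, fun _ => hole_of_le (by omega)⟩

lemma hole_moveLL {ℓ : Fin n} {x : Finset (Fin n)} (h : (ℓ : ℕ) + 1 < n) (q : ℕ) :
    Hole (moveLL n ℓ x) q ↔ q ≠ ℓ ∧ (q = ℓ + 1 ∨ Hole x q) := by
  rw [moveLL, dif_pos h]
  by_cases hq : q < n
  · simp only [Hole, hq, forall_true_left, Finset.mem_insert, Finset.mem_erase, Fin.ext_iff, ne_eq]
    tauto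
  · have h1 : q ≠ ℓ := by omega
    exact ⟨fun _ => ⟨h1, Or.inr (hole_of_le (by omega))⟩, fun _ => hole_of_le (by omega)⟩

lemma _root_.ValidRL.lt {ℓ : Fin n} {x : Finset (Fin n)} (h : ValidRL n k ℓ x) :
    (ℓ : ℕ) + 1 < n := h.2.1

lemma _root_.ValidLL.lt {ℓ : Fin n} {x : Finset (Fin n)} (h : ValidLL n k ℓ x) :
    (ℓ : ℕ) + 1 < n := h.2.1

lemma card_moveRL {ℓ : Fin n} {x : Finset (Fin n)} (h : ValidRL n k ℓ x) :
    (moveRL n ℓ x).card = k := by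
  obtain ⟨h0, h1, h2, h3⟩ := h
  rw [moveRL, dif_pos h1, Finset.card_insert_of_notMem (by simp [h3]), Finset.card_erase_of_mem h2,
    ← h0]
  have := Finset.card_pos.mpr ⟨_, h2⟩
  omega

lemma card_moveLL {ℓ : Fin n} {x : Finset (Fin n)} (h : ValidLL n k ℓ x) :
    (moveLL n ℓ x).card = k := by
  obtain ⟨h0, h1, h2, h3⟩ := h
  rw [moveLL, dif_pos h1, Finset.card_insert_of_notMem (by simp [h3]), Finset.card_erase_of_mem h2,
    ← h0]
  have := Finset.card_pos.mpr ⟨_, h2⟩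
  omega

lemma validLL_moveRL {ℓ : Fin n} {x : Finset (Fin n)} (h : ValidRL n k ℓ x) :
    ValidLL n k ℓ (moveRL n ℓ x) := by
  rw [validLL_iff, hole_moveRL h.lt, hole_moveRL h.lt]
  exact ⟨card_moveRL h, h.lt, by simp, by simp⟩

lemma validRL_moveLL {ℓ : Fin n} {x : Finset (Fin n)} (h : ValidLL n k ℓ x) :
    ValidRL n k ℓ (moveLL n ℓ x) := by
  rw [validRL_iff, hole_moveLL h.lt, hole_moveLL h.lt]
  exact ⟨card_moveLL h, h.lt, by simp, by simp⟩

lemma moveLL_moveRL {ℓ : Fin n} {x : Finset (Fin n)} (h : ValidRL n k ℓ x) :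
    moveLL n ℓ (moveRL n ℓ x) = x := by
  obtain ⟨-, -, h2, h3⟩ := validRL_iff.1 h
  refine ext_hole fun q => ?_
  rw [hole_moveLL h.lt, hole_moveRL h.lt]
  grind

lemma moveRL_moveLL {ℓ : Fin n} {x : Finset (Fin n)} (h : ValidLL n k ℓ x) :
    moveRL n ℓ (moveLL n ℓ x) = x := by
  obtain ⟨-, -, h2, h3⟩ := validLL_iff.1 h
  refine ext_hole fun q => ?_
  rw [hole_moveRL h.lt, hole_moveLL h.lt]
  grind

section Distant

variable {ℓ ℓ' : Fin n} {x : Finset (Fin n)}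

lemma validRL_moveRL_distant (hd : (ℓ : ℕ) + 1 < (ℓ' : ℕ) ∨ (ℓ' : ℕ) + 1 < (ℓ : ℕ))
    (h1 : ValidRL n k ℓ x) (h2 : ValidRL n k ℓ' (moveRL n ℓ x)) :
    ValidRL n k ℓ' x ∧ ValidRL n k ℓ (moveRL n ℓ' x) ∧
      moveRL n ℓ' (moveRL n ℓ x) = moveRL n ℓ (moveRL n ℓ' x) := by
  have h1' := validRL_iff.1 h1
  have h2' := validRL_iff.1 h2
  have h3 : ValidRL n k ℓ' x := by
    rw [validRL_iff]; rw [hole_moveRL h1.lt, hole_moveRL h1.lt] at h2'; grind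
  refine ⟨h3, ?_, ext_hole fun q => ?_⟩
  · have := card_moveRL h3
    rw [validRL_iff, hole_moveRL h2.lt, hole_moveRL h2.lt]; grind
  · rw [hole_moveRL h2.lt, hole_moveRL h1.lt, hole_moveRL h1.lt, hole_moveRL h2.lt]; grind

lemma validLL_moveLL_distant (hd : (ℓ : ℕ) + 1 < (ℓ' : ℕ) ∨ (ℓ' : ℕ) + 1 < (ℓ : ℕ))
    (h1 : ValidLL n k ℓ x) (h2 : ValidLL n k ℓ' (moveLL n ℓ x)) :
    ValidLL n k ℓ' x ∧ ValidLL n k ℓ (moveLL n ℓ' x) ∧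
      moveLL n ℓ' (moveLL n ℓ x) = moveLL n ℓ (moveLL n ℓ' x) := by
  have h1' := validLL_iff.1 h1
  have h2' := validLL_iff.1 h2
  have h3 : ValidLL n k ℓ' x := by
    rw [validLL_iff]; rw [hole_moveLL h1.lt, hole_moveLL h1.lt] at h2'; grind
  refine ⟨h3, ?_, ext_hole fun q => ?_⟩
  · have := card_moveLL h3
    rw [validLL_iff, hole_moveLL h2.lt, hole_moveLL h2.lt]; grind
  · rw [hole_moveLL h2.lt, hole_moveLL h1.lt, hole_moveLL h1.lt, hole_moveLL h2.lt]; grind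

lemma validRL_moveLL_distant (hd : (ℓ : ℕ) + 1 < (ℓ' : ℕ) ∨ (ℓ' : ℕ) + 1 < (ℓ : ℕ))
    (h1 : ValidLL n k ℓ x) (h2 : ValidRL n k ℓ' (moveLL n ℓ x)) :
    ValidRL n k ℓ' x ∧ ValidLL n k ℓ (moveRL n ℓ' x) ∧
      moveRL n ℓ' (moveLL n ℓ x) = moveLL n ℓ (moveRL n ℓ' x) := by
  have h1' := validLL_iff.1 h1
  have h2' := validRL_iff.1 h2
  have h3 : ValidRL n k ℓ' x := by
    rw [validRL_iff]; rw [hole_moveLL h1.lt, hole_moveLL h1.lt] at h2'; grind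
  refine ⟨h3, ?_, ext_hole fun q => ?_⟩
  · have := card_moveRL h3
    rw [validLL_iff, hole_moveRL h2.lt, hole_moveRL h2.lt]; grind
  · rw [hole_moveRL h2.lt, hole_moveLL h1.lt, hole_moveLL h1.lt, hole_moveRL h2.lt]; grind

lemma validLL_moveRL_distant (hd : (ℓ : ℕ) + 1 < (ℓ' : ℕ) ∨ (ℓ' : ℕ) + 1 < (ℓ : ℕ))
    (h1 : ValidRL n k ℓ x) (h2 : ValidLL n k ℓ' (moveRL n ℓ x)) :
    ValidLL n k ℓ' x ∧ ValidRL n k ℓ (moveLL n ℓ' x) := by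
  have h1' := validRL_iff.1 h1
  have h2' := validLL_iff.1 h2
  have h3 : ValidLL n k ℓ' x := by
    rw [validLL_iff]; rw [hole_moveRL h1.lt, hole_moveRL h1.lt] at h2'; grind
  refine ⟨h3, ?_⟩
  have := card_moveLL h3
  rw [validRL_iff, hole_moveLL h2.lt, hole_moveLL h2.lt]; grind

end Distant

/-! ### Configurations adapted to a set of edges -/

/-- No two holes of `x` are joined by edges in `T`; the edge `ℓ` joins `ℓ` to `ℓ + 1`. -/
def Good (T x : Finset (Fin n)) : Prop :=
  ∀ p q : ℕ, p < q → q ≤ n → Hole x p → Hole x q → ∃ e : Fin n, p ≤ e ∧ (e : ℕ) < q ∧ e ∉ T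

lemma Good.mono {S T x : Finset (Fin n)} (h : Good T x) (hST : S ⊆ T) : Good S x := by
  intro p q h1 h2 h3 h4
  obtain ⟨e, h5, h6, h7⟩ := h p q h1 h2 h3 h4
  exact ⟨e, h5, h6, fun h => h7 (hST h)⟩

lemma Good.moveRL {T x : Finset (Fin n)} {ℓ : Fin n} (hT : ℓ ∈ T) (hv : ValidRL n k ℓ x)
    (h : Good T x) : Good T (moveRL n ℓ x) := by
  obtain ⟨-, -, h2, h3⟩ := validRL_iff.1 hv
  intro p q hpq hq hp hq'
  rw [hole_moveRL hv.lt] at hp hq'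
  have key : ∀ p q : ℕ, p < q → q ≤ n → p ≠ ℓ + 1 → q ≠ ℓ + 1 →
      Hole x (if p = ℓ then ℓ + 1 else p) → Hole x (if q = ℓ then ℓ + 1 else q) →
      ∃ e : Fin n, p ≤ e ∧ (e : ℕ) < q ∧ e ∉ T := by
    intro p q hpq hq hp1 hq1 hp hq'
    have hl := hv.lt
    obtain ⟨e, h5, h6, h7⟩ := h _ _ (by split_ifs <;> omega) (by split_ifs <;> omega) hp hq'
    have : e ≠ ℓ := fun h => h7 (h ▸ hT)
    have : (e : ℕ) ≠ ℓ := fun h => this (Fin.ext h)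
    refine ⟨e, ?_, ?_, h7⟩ <;> split_ifs at h5 h6 <;> omega
  refine key p q hpq hq hp.1 hq'.1 ?_ ?_ <;> split_ifs with hh
  · exact h3
  · tauto
  · exact h3
  · tauto

lemma Good.moveLL {T x : Finset (Fin n)} {ℓ : Fin n} (hT : ℓ ∈ T) (hv : ValidLL n k ℓ x)
    (h : Good T x) : Good T (moveLL n ℓ x) := by
  obtain ⟨-, -, h2, h3⟩ := validLL_iff.1 hv
  intro p q hpq hq hp hq'
  rw [hole_moveLL hv.lt] at hp hq'
  have key : ∀ p q : ℕ, p < q → q ≤ n → p ≠ ℓ → q ≠ ℓ →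
      Hole x (if p = ℓ + 1 then ℓ else p) → Hole x (if q = ℓ + 1 then ℓ else q) →
      ∃ e : Fin n, p ≤ e ∧ (e : ℕ) < q ∧ e ∉ T := by
    intro p q hpq hq hp1 hq1 hp hq'
    have hl := hv.lt
    obtain ⟨e, h5, h6, h7⟩ := h _ _ (by split_ifs <;> omega) (by split_ifs <;> omega) hp hq'
    have : e ≠ ℓ := fun h => h7 (h ▸ hT)
    have : (e : ℕ) ≠ ℓ := fun h => this (Fin.ext h)
    refine ⟨e, ?_, ?_, h7⟩ <;> split_ifs at h5 h6 <;> omega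
  refine key p q hpq hq hp.1 hq'.1 ?_ ?_ <;> split_ifs with hh
  · exact h2
  · tauto
  · exact h2
  · tauto

lemma not_good_of_hole {T x : Finset (Fin n)} {ℓ : Fin n} (hT : ℓ ∈ T) (h1 : Hole x ℓ)
    (h2 : Hole x (ℓ + 1)) : ¬ Good T x := by
  intro h
  obtain ⟨e, h3, h4, h5⟩ := h ℓ (ℓ + 1) (by omega) (by omega) h1 h2
  have : e = ℓ := Fin.ext (by omega)
  exact h5 (this ▸ hT)

lemma good_self (T : Finset (Fin n)) : Good T T := fun p q hpq hq hp _ =>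
  ⟨⟨p, by omega⟩, le_rfl, hpq, hp (by omega)⟩

/-- An adapted configuration has at least as many dots as there are edges. -/
lemma Good.card_le {T x : Finset (Fin n)} (h : Good T x) : T.card ≤ x.card := by
  have key : ∀ p : Fin n, p ∈ xᶜ → ∃ e : Fin n, e ∈ Tᶜ ∧ p ≤ e ∧ ∀ q ∈ xᶜ, p < q → e < q := by
    intro p hp
    rw [Finset.mem_compl] at hp
    have hex : ∃ m : ℕ, ∃ hm : m < n, (p : ℕ) ≤ m ∧ (⟨m, hm⟩ : Fin n) ∉ T := by
      obtain ⟨e, h1, h2, h3⟩ := h p n p.isLt le_rfl (hole_val.2 hp) (hole_of_le le_rfl)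
      exact ⟨e, h2, h1, h3⟩
    classical
    obtain ⟨hm, h1, h2⟩ := Nat.find_spec hex
    refine ⟨⟨Nat.find hex, hm⟩, by simpa using h2, h1, fun q hq hpq => ?_⟩
    rw [Finset.mem_compl] at hq
    obtain ⟨e, h4, h5, h6⟩ := h p q hpq q.isLt.le (hole_val.2 hp) (hole_val.2 hq)
    exact lt_of_le_of_lt (Nat.find_min' hex ⟨e.isLt, h4, h6⟩) h5
  choose! f hf1 hf2 hf3 using key
  have hinj : Set.InjOn f (xᶜ : Finset (Fin n)) := by
    intro p hp q hq hpq
    rcases lt_trichotomy p q with h | h | h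
    · exact absurd (hf3 p hp q hq h) (not_lt.2 (hpq ▸ hf2 q hq))
    · exact h
    · exact absurd (hf3 q hq p hp h) (not_lt.2 (hpq ▸ hf2 p hp))
  have := Finset.card_le_card_of_injOn f hf1 hinj
  rw [Finset.card_compl, Finset.card_compl, Fintype.card_fin] at this
  have := Finset.card_le_univ x
  have := Finset.card_le_univ T
  simp only [Fintype.card_fin] at *
  omega

/-- If no dot can move left without destroying adaptedness, the holes are determined by their
number: they form an upper set of the complement of `S`. -/
lemma hole_of_terminal {S x : Finset (Fin n)} (hS : Good S x)
    (ht : ∀ ℓ, ValidLL n k ℓ x → ¬ Good (insert ℓ S) x) (hx : x.card = k) :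
    (∀ p : Fin n, p ∉ x → p ∉ S) ∧
      ∀ p p' : Fin n, p < p' → p ∉ x → p' ∉ S → p' ∉ x := by
  have h1 : ∀ p : Fin n, p ∉ x → p ∉ S := by
    intro p hp hpS
    by_cases hh : Hole x (p + 1)
    · exact not_good_of_hole hpS (hole_val.2 hp) hh hS
    · have hlt : (p : ℕ) + 1 < n := by
        by_contra h
        exact hh (hole_of_le (by omega))
      refine ht p (validLL_iff.2 ⟨hx, hlt, hole_val.2 hp, hh⟩) ?_
      rwa [Finset.insert_eq_of_mem hpS]
  refine ⟨h1, ?_⟩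
  by_contra! hcon
  obtain ⟨p, p', hpp, hp, hp'S, hp'⟩ := hcon
  -- the last hole before `p'`
  obtain ⟨q, hq, hqmax⟩ := Finset.exists_max_image
    (Finset.univ.filter fun q : Fin n => q < p' ∧ q ∉ x) id ⟨p, by simp [hpp, hp]⟩
  simp only [Finset.mem_filter, Finset.mem_univ, true_and, id] at hq hqmax
  have hdot : ∀ r : ℕ, (q : ℕ) < r → r ≤ p' → ¬ Hole x r := by
    intro r h2 h3 h4
    have hr : r < n := by omega
    rcases h3.eq_or_lt with h3 | h3
    · subst h3
      exact hole_val.1 h4 hp'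
    · have := hqmax ⟨r, hr⟩ ⟨h3, h4 hr⟩
      exact absurd h2 (not_lt.2 this)
  have hqp : (q : ℕ) < p' := hq.1
  refine ht q (validLL_iff.2 ⟨hx, by omega, hole_val.2 hq.2, hdot _ (by omega) (by omega)⟩) ?_
  intro a b hab hb ha hb'
  rcases lt_trichotomy a q with h | h | h
  · obtain ⟨e, h5, h6, h7⟩ := hS a q h q.isLt.le ha (hole_val.2 hq.2)
    by_cases hbq : (q : ℕ) ≤ b
    · refine ⟨e, h5, by omega, ?_⟩
      rw [Finset.mem_insert, not_or]
      exact ⟨fun h => by rw [h] at h6; omega, h7⟩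
    · obtain ⟨e, h5, h6, h7⟩ := hS a b hab hb ha hb'
      refine ⟨e, h5, by omega, ?_⟩
      rw [Finset.mem_insert, not_or]
      exact ⟨fun h => by rw [h] at h6; omega, h7⟩
  · refine ⟨p', by omega, ?_, ?_⟩
    · by_contra hcon
      exact hdot b (by omega) (by omega) hb'
    · rw [Finset.mem_insert, not_or]
      exact ⟨fun h => by rw [h] at hqp; omega, hp'S⟩
  · obtain ⟨e, h5, h6, h7⟩ := hS a b hab hb ha hb'
    refine ⟨e, h5, h6, ?_⟩
    rw [Finset.mem_insert, not_or]
    exact ⟨fun h => by rw [h] at h5; omega, h7⟩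

lemma eq_of_terminal {S x y : Finset (Fin n)} (hx : Good S x) (hy : Good S y)
    (hxt : ∀ ℓ, ValidLL n k ℓ x → ¬ Good (insert ℓ S) x)
    (hyt : ∀ ℓ, ValidLL n k ℓ y → ¬ Good (insert ℓ S) y)
    (hxk : x.card = k) (hyk : y.card = k) : x = y := by
  obtain ⟨hx1, hx2⟩ := hole_of_terminal hx hxt hxk
  obtain ⟨hy1, hy2⟩ := hole_of_terminal hy hyt hyk
  have : x ⊆ y ∨ y ⊆ x := by
    by_contra! hcon
    obtain ⟨⟨a, ha, ha'⟩, ⟨b, hb, hb'⟩⟩ := hcon.imp Finset.not_subset.1 Finset.not_subset.1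
    rcases lt_trichotomy a b with h | h | h
    · exact hy2 a b h ha' (hx1 b hb') hb
    · exact hb' (h ▸ ha)
    · exact hx2 b a h hb' (hy1 a ha') ha
  rcases this with h | h
  · exact Finset.eq_of_subset_of_card_le h (by omega)
  · exact (Finset.eq_of_subset_of_card_le h (by omega)).symm

lemma exists_terminal {α : Type*} {S : Finset (Fin n)} (c : Finset (Fin n) → α)
    (hc : ∀ ℓ x, ValidLL n k ℓ x → Good (insert ℓ S) x → c (moveLL n ℓ x) = c x) :
    ∀ (N : ℕ) (x : Finset (Fin n)), ∑ i ∈ x, (i : ℕ) ≤ N → x.card = k → Good S x →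
      ∃ y, y.card = k ∧ Good S y ∧ c y = c x ∧
        ∀ ℓ, ValidLL n k ℓ y → ¬ Good (insert ℓ S) y := by
  intro N
  induction N with
  | zero =>
    intro x hN hx hg
    refine ⟨x, hx, hg, rfl, fun ℓ hv _ => ?_⟩
    obtain ⟨-, h1, h2, -⟩ := hv
    have := Finset.single_le_sum (f := fun i : Fin n => (i : ℕ)) (fun _ _ => Nat.zero_le _) h2
    simp only at this
    omega
  | succ N ih =>
    intro x hN hx hg
    by_cases ht : ∀ ℓ, ValidLL n k ℓ x → ¬ Good (insert ℓ S) x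
    · exact ⟨x, hx, hg, rfl, ht⟩
    · push Not at ht
      obtain ⟨ℓ, hv, hgx⟩ := ht
      have hsum : ∑ i ∈ moveLL n ℓ x, (i : ℕ) ≤ N := by
        obtain ⟨-, h1, h2, h3⟩ := hv
        have h4 := Finset.add_sum_erase x (fun i : Fin n => (i : ℕ)) h2
        rw [moveLL, dif_pos h1, Finset.sum_insert (by simp [h3])]
        simp only at h4
        omega
      obtain ⟨y, h1, h2, h3, h4⟩ := ih (moveLL n ℓ x) hsum (card_moveLL hv)
        ((hgx.moveLL (Finset.mem_insert_self _ _) hv).mono (Finset.subset_insert _ _))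
      exact ⟨y, h1, h2, h3.trans (hc ℓ x hv hgx), h4⟩

/-- A function on configurations which is invariant under moves along edges that keep the
configuration adapted is constant on adapted configurations. -/
lemma eq_of_invariant {α : Type*} {S : Finset (Fin n)} (c : Finset (Fin n) → α)
    (hc : ∀ ℓ x, ValidLL n k ℓ x → Good (insert ℓ S) x → c (moveLL n ℓ x) = c x)
    {x y : Finset (Fin n)} (hx : x.card = k) (hy : y.card = k) (hxg : Good S x) (hyg : Good S y) :
    c x = c y := by
  obtain ⟨x', h1, h2, h3, h4⟩ := exists_terminal c hc _ x le_rfl hx hxg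
  obtain ⟨y', h1', h2', h3', h4'⟩ := exists_terminal c hc _ y le_rfl hy hyg
  rw [← h3, ← h3', eq_of_terminal h2 h2' h4 h4' h1 h1']

end Configurations

/-! ### Elementary operators -/

section Elementary

variable {ι K : Type*} [CommRing K] (P : ι → Prop)

open Classical in
/-- Evaluation at `y`, extended by zero to all indices. -/
noncomputable def evalZero (y : ι) : ({x // P x} → K) →ₗ[K] K :=
  if h : P y then LinearMap.proj ⟨y, h⟩ else 0

lemma evalZero_of_not {y : ι} (h : ¬ P y) : evalZero (K := K) P y = 0 := by
  rw [evalZero, dif_neg h]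

open Classical in
/-- The matrix unit at `(x, y)` with coefficient `c`, zero if an index does not satisfy `P`. -/
noncomputable def elemOp (x y : ι) (c : K) : Module.End K ({x // P x} → K) :=
  LinearMap.pi fun v => if v.1 = x then c • evalZero P y else 0

variable {P}

open Classical in
lemma elemOp_apply (x y : ι) (c : K) (f : {x // P x} → K) (v : {x // P x}) :
    elemOp P x y c f v = if v.1 = x then c * evalZero P y f else 0 := by
  rw [elemOp, LinearMap.pi_apply]
  split_ifs <;> rfl

lemma elemOp_zero (x y : ι) : elemOp (K := K) P x y 0 = 0 := by
  ext f v
  simp [elemOp]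

lemma elemOp_eq_zero_left {x : ι} (hx : ¬ P x) (y : ι) (c : K) : elemOp P x y c = 0 := by
  refine LinearMap.ext fun f => funext fun v => ?_
  have : v.1 ≠ x := fun h => hx (h ▸ v.2)
  simp [elemOp, this]

open Classical in
lemma evalZero_elemOp (w x y : ι) (c : K) (f : {x // P x} → K) :
    evalZero P w (elemOp P x y c f) = if P x ∧ w = x then c * evalZero P y f else 0 := by
  by_cases hw : P w
  · have h1 : evalZero P w (elemOp P x y c f) = elemOp P x y c f ⟨w, hw⟩ := by
      rw [evalZero, dif_pos hw]
      rfl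
    rw [h1, elemOp_apply]
    by_cases hwx : w = x
    · simp [hwx, hwx ▸ hw]
    · simp [hwx]
  · have : ¬ (P x ∧ w = x) := fun h => hw (h.2 ▸ h.1)
    rw [evalZero_of_not P hw, if_neg this]
    rfl

lemma elemOp_mul_of_ne {y y' : ι} (h : y ≠ y') (x z : ι) (c d : K) :
    elemOp P x y c * elemOp P y' z d = 0 := by
  refine LinearMap.ext fun f => funext fun v => ?_
  rw [Module.End.mul_apply, elemOp_apply, evalZero_elemOp]
  simp [h]

lemma elemOp_mul {x y : ι} (z : ι) {c d : K} (h : P x → c * d ≠ 0 → P y) :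
    elemOp P x y c * elemOp P y z d = elemOp P x z (c * d) := by
  by_cases hx : P x
  · refine LinearMap.ext fun f => funext fun v => ?_
    rw [Module.End.mul_apply, elemOp_apply, elemOp_apply, evalZero_elemOp]
    by_cases hcd : c * d = 0
    · simp [← mul_assoc, hcd]
    · simp [h hx hcd, mul_assoc]
  · rw [elemOp_eq_zero_left hx, elemOp_eq_zero_left hx, zero_mul]

lemma elemOp_injective {x y : ι} (hx : P x) (hy : P y) {c d : K}
    (h : elemOp P x y c = elemOp P x y d) : c = d := by
  classical
  have := congrFun (LinearMap.congr_fun h (Pi.single ⟨y, hy⟩ 1)) ⟨x, hx⟩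
  simpa [elemOp, evalZero, hy] using this

lemma sum_elemOp (s : Finset ι) (hs : ∀ x, P x → x ∈ s) (c : K) :
    ∑ x ∈ s, elemOp P x x c = c • 1 := by
  refine LinearMap.ext fun f => funext fun v => ?_
  rw [LinearMap.sum_apply, Finset.sum_apply, Finset.sum_eq_single v.1]
  · simp [elemOp, evalZero, v.2]
  · intro b _ hb
    simp [elemOp, hb.symm]
  · intro h
    exact absurd (hs _ v.2) h

end Elementary

/-! ### The representation of `ℬ_l(n,k)` attached to a set of edges -/

section Representation

open MvPolynomial

variable {n : ℕ} (k : ℕ) (T : Finset (Fin n))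

/-- The variable `X ℓ` if `ℓ ∈ T`, and zero otherwise. -/
noncomputable def edgeVar (ℓ : Fin n) : MvPolynomial (Fin n) ℤ := if ℓ ∈ T then X ℓ else 0

/-- One if `ℓ ∈ T`, and zero otherwise. -/
noncomputable def edgeInd (ℓ : Fin n) : MvPolynomial (Fin n) ℤ := if ℓ ∈ T then 1 else 0

/-- The `k`-dot configurations adapted to `T`. -/
def Adapted (x : Finset (Fin n)) : Prop := x.card = k ∧ Good T x

/-- The module on which `ℬ_l(n,k)` acts. -/
abbrev AdaptedModule := {x : Finset (Fin n) // Adapted k T x} → MvPolynomial (Fin n) ℤ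

open Classical in
/-- The action of the generators of `ℬ_l(n,k)`. -/
noncomputable def genOp : OSGen n → Module.End (MvPolynomial (Fin n) ℤ) (AdaptedModule k T)
  | OSGen.I x => elemOp (Adapted k T) x x 1
  | OSGen.R ℓ x =>
    if ValidRL n k ℓ x then elemOp (Adapted k T) x (moveRL n ℓ x) (edgeVar T ℓ) else 0
  | OSGen.L ℓ y =>
    if ValidLL n k ℓ y then elemOp (Adapted k T) y (moveLL n ℓ y) (edgeInd T ℓ) else 0
  | OSGen.U ℓ x => elemOp (Adapted k T) x x (edgeVar T ℓ)

variable {k T}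

lemma edgeVar_mul_edgeInd (ℓ : Fin n) : edgeVar T ℓ * edgeInd T ℓ = edgeVar T ℓ := by
  unfold edgeVar edgeInd
  split_ifs <;> simp

lemma edgeInd_mul_edgeVar (ℓ : Fin n) : edgeInd T ℓ * edgeVar T ℓ = edgeVar T ℓ := by
  rw [mul_comm, edgeVar_mul_edgeInd]

lemma mem_of_edgeVar_ne {ℓ : Fin n} (h : edgeVar T ℓ ≠ 0) : ℓ ∈ T := by
  by_contra hh
  exact h (if_neg hh)

lemma mem_of_edgeInd_ne {ℓ : Fin n} (h : edgeInd T ℓ ≠ 0) : ℓ ∈ T := by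
  by_contra hh
  exact h (if_neg hh)

lemma Adapted.moveRL {ℓ : Fin n} {x : Finset (Fin n)} (hv : ValidRL n k ℓ x) (hT : ℓ ∈ T)
    (h : Adapted k T x) : Adapted k T (moveRL n ℓ x) := ⟨card_moveRL hv, h.2.moveRL hT hv⟩

lemma Adapted.moveLL {ℓ : Fin n} {x : Finset (Fin n)} (hv : ValidLL n k ℓ x) (hT : ℓ ∈ T)
    (h : Adapted k T x) : Adapted k T (moveLL n ℓ x) := ⟨card_moveLL hv, h.2.moveLL hT hv⟩

lemma sum_adapted (c : MvPolynomial (Fin n) ℤ) :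
    ∑ x ∈ Finset.univ.filter (fun x : Finset (Fin n) => x.card = k), elemOp (Adapted k T) x x c =
      c • 1 :=
  sum_elemOp _ (fun x hx => by simpa using hx.1) c

lemma lift_genOp_totUL (j : Fin n) :
    FreeAlgebra.lift ℤ (genOp k T) (totUL n k j) = edgeVar T j • 1 := by
  simp only [totUL, og, map_sum, FreeAlgebra.lift_ι_apply, genOp]
  exact sum_adapted _

lemma lift_genOp_rel ⦃a b : FreeAlgebra ℤ (OSGen n)⦄ (h : OSRelL n k a b) :
    FreeAlgebra.lift ℤ (genOp k T) a = FreeAlgebra.lift ℤ (genOp k T) b := by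
  induction h with
  | idem_mul x y =>
    split_ifs with hxy
    · subst hxy
      simp only [map_mul, FreeAlgebra.lift_ι_apply, genOp]
      rw [elemOp_mul _ (fun h _ => h), mul_one]
    · simp only [map_mul, FreeAlgebra.lift_ι_apply, genOp, map_zero]
      exact elemOp_mul_of_ne hxy _ _ _ _
  | idem_sum =>
    simp only [og, map_sum, FreeAlgebra.lift_ι_apply, genOp, map_one]
    rw [sum_adapted, one_smul]
  | idem_junk x h =>
    simp only [FreeAlgebra.lift_ι_apply, genOp, map_zero]
    exact elemOp_eq_zero_left (fun hx => h hx.1) _ _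
  | R_junk ℓ x h => simp only [FreeAlgebra.lift_ι_apply, genOp, map_zero, if_neg h]
  | L_junk ℓ y h => simp only [FreeAlgebra.lift_ι_apply, genOp, map_zero, if_neg h]
  | U_junk ℓ x h =>
    simp only [FreeAlgebra.lift_ι_apply, genOp, map_zero]
    exact elemOp_eq_zero_left (fun hx => h hx.1) _ _
  | R_src ℓ x =>
    simp only [map_mul, FreeAlgebra.lift_ι_apply, genOp]
    split_ifs
    · rw [elemOp_mul _ (fun h _ => h), one_mul]
    · rw [mul_zero]
  | R_tgt ℓ x =>
    simp only [map_mul, FreeAlgebra.lift_ι_apply, genOp]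
    split_ifs with hv
    · rw [elemOp_mul _ (fun h h' => h.moveRL hv (mem_of_edgeVar_ne (left_ne_zero_of_mul h'))),
        mul_one]
    · rw [zero_mul]
  | L_src ℓ x =>
    simp only [map_mul, FreeAlgebra.lift_ι_apply, genOp]
    split_ifs
    · rw [elemOp_mul _ (fun h _ => h), one_mul]
    · rw [mul_zero]
  | L_tgt ℓ x =>
    simp only [map_mul, FreeAlgebra.lift_ι_apply, genOp]
    split_ifs with hv
    · rw [elemOp_mul _ (fun h h' => h.moveLL hv (mem_of_edgeInd_ne (left_ne_zero_of_mul h'))),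
        mul_one]
    · rw [zero_mul]
  | U_src ℓ x =>
    simp only [map_mul, FreeAlgebra.lift_ι_apply, genOp]
    rw [elemOp_mul _ (fun h _ => h), one_mul]
  | U_tgt ℓ x =>
    simp only [map_mul, FreeAlgebra.lift_ι_apply, genOp]
    rw [elemOp_mul _ (fun h _ => h), mul_one]
  | U_comm_R j ℓ x =>
    simp only [map_mul, lift_genOp_totUL, smul_mul_assoc, one_mul, mul_smul_comm, mul_one]
  | U_comm_L j ℓ x =>
    simp only [map_mul, lift_genOp_totUL, smul_mul_assoc, one_mul, mul_smul_comm, mul_one]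
  | U_comm_U j ℓ x =>
    simp only [map_mul, lift_genOp_totUL, smul_mul_assoc, one_mul, mul_smul_comm, mul_one]
  | RL_eq_U ℓ x h =>
    simp only [map_mul, FreeAlgebra.lift_ι_apply, genOp]
    rw [if_pos h, if_pos (validLL_moveRL h), moveLL_moveRL h,
      elemOp_mul _ (fun h1 h' => h1.moveRL h (mem_of_edgeVar_ne (left_ne_zero_of_mul h'))),
      edgeVar_mul_edgeInd]
  | LR_eq_U ℓ x h =>
    simp only [map_mul, FreeAlgebra.lift_ι_apply, genOp]
    rw [if_pos h, if_pos (validLL_moveRL h), moveLL_moveRL h, elemOp_mul _ (fun h1 h' => ?_),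
      edgeInd_mul_edgeVar]
    have := h1.moveLL (validLL_moveRL h) (mem_of_edgeInd_ne (left_ne_zero_of_mul h'))
    rwa [moveLL_moveRL h] at this
  | RR_comm ℓ ℓ' x hd h1 h2 =>
    obtain ⟨h3, h4, h5⟩ := validRL_moveRL_distant hd h1 h2
    simp only [map_mul, FreeAlgebra.lift_ι_apply, genOp]
    rw [if_pos h1, if_pos h2, if_pos h3, if_pos h4, h5,
      elemOp_mul _ (fun h h' => h.moveRL h1 (mem_of_edgeVar_ne (left_ne_zero_of_mul h'))),
      elemOp_mul _ (fun h h' => h.moveRL h3 (mem_of_edgeVar_ne (left_ne_zero_of_mul h'))), mul_comm]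
  | LL_comm ℓ ℓ' x hd h1 h2 =>
    obtain ⟨h3, h4, h5⟩ := validLL_moveLL_distant hd h1 h2
    simp only [map_mul, FreeAlgebra.lift_ι_apply, genOp]
    rw [if_pos h1, if_pos h2, if_pos h3, if_pos h4, h5,
      elemOp_mul _ (fun h h' => h.moveLL h1 (mem_of_edgeInd_ne (left_ne_zero_of_mul h'))),
      elemOp_mul _ (fun h h' => h.moveLL h3 (mem_of_edgeInd_ne (left_ne_zero_of_mul h'))), mul_comm]
  | LR_comm ℓ ℓ' x hd h1 h2 =>
    obtain ⟨h3, h4, h5⟩ := validRL_moveLL_distant hd h1 h2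
    simp only [map_mul, FreeAlgebra.lift_ι_apply, genOp]
    rw [if_pos h1, if_pos h2, if_pos h3, if_pos h4, h5,
      elemOp_mul _ (fun h h' => h.moveLL h1 (mem_of_edgeInd_ne (left_ne_zero_of_mul h'))),
      elemOp_mul _ (fun h h' => h.moveRL h3 (mem_of_edgeVar_ne (left_ne_zero_of_mul h'))), mul_comm]
  | RR_zero ℓ ℓ' x h =>
    simp only [map_mul, FreeAlgebra.lift_ι_apply, genOp, map_zero]
    split_ifs with h1 h2
    · have h1' := (validRL_iff.1 h1).2.2.2
      have h2' := (validRL_iff.1 h2).2.2.2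
      rw [hole_moveRL h1.lt, h] at h2'
      rw [elemOp_mul _ (fun h h' => h.moveRL h1 (mem_of_edgeVar_ne (left_ne_zero_of_mul h')))]
      by_cases hT : ℓ' ∈ T
      · refine elemOp_eq_zero_left (fun hx => not_good_of_hole hT ?_ ?_ hx.2) _ _
        · rwa [h]
        · rw [h]
          exact h2'.2.resolve_left (by omega)
      · simp [edgeVar, hT, elemOp_zero]
    all_goals simp
  | LL_zero ℓ ℓ' x h =>
    simp only [map_mul, FreeAlgebra.lift_ι_apply, genOp, map_zero]
    split_ifs with h1 h2
    · have h1' := (validLL_iff.1 h1).2.2.1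
      have h2' := (validLL_iff.1 h2).2.2.1
      rw [hole_moveLL h1.lt] at h2'
      rw [elemOp_mul _ (fun h h' => h.moveLL h1 (mem_of_edgeInd_ne (left_ne_zero_of_mul h')))]
      by_cases hT : ℓ' ∈ T
      · refine elemOp_eq_zero_left (fun hx => not_good_of_hole hT ?_ ?_ hx.2) _ _
        · exact h2'.2.resolve_left (by omega)
        · rwa [← h]
      · simp [edgeInd, hT, elemOp_zero]
    all_goals simp
  | U_vanish ℓ x h1 h2 =>
    simp only [FreeAlgebra.lift_ι_apply, genOp, map_zero]
    by_cases hT : ℓ ∈ T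
    · exact elemOp_eq_zero_left (fun hx => not_good_of_hole hT (hole_val.2 h1) h2 hx.2) _ _
    · simp [edgeVar, hT, elemOp_zero]

variable (k T) in
/-- The representation of `ℬ_l(n,k)` on functions on the configurations adapted to `T`. -/
noncomputable def rep :
    OSAlgL n k →+* Module.End (MvPolynomial (Fin n) ℤ) (AdaptedModule k T) :=
  RingQuot.lift ⟨(FreeAlgebra.lift ℤ (genOp k T) : FreeAlgebra ℤ (OSGen n) →ₐ[ℤ] _).toRingHom,
    lift_genOp_rel⟩

lemma rep_mk (a : FreeAlgebra ℤ (OSGen n)) :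
    rep k T (RingQuot.mkRingHom (OSRelL n k) a) = FreeAlgebra.lift ℤ (genOp k T) a :=
  RingQuot.lift_mkRingHom_apply _ _ _

/-- Setting the variables outside `T` to zero keeps the coefficients supported on `T`. -/
lemma coeff_aeval_edgeVar (p : MvPolynomial (Fin n) ℤ) {m : Fin n →₀ ℕ} (hm : m.support ⊆ T) :
    coeff m (aeval (edgeVar T) p) = coeff m p := by
  induction p using MvPolynomial.induction_on' with
  | monomial s a =>
    rw [aeval_monomial]
    by_cases hs : s.support ⊆ T
    · have : (s.prod fun i e => edgeVar T i ^ e) = s.prod fun i e => (X i : MvPolynomial _ ℤ) ^ e :=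
        Finsupp.prod_congr fun i hi => by rw [edgeVar, if_pos (hs hi)]
      rw [this, monomial_eq]
      rfl
    · obtain ⟨i, hi, hiT⟩ := Finset.not_subset.1 hs
      have h0 : (s.prod fun i e => edgeVar T i ^ e) = 0 :=
        Finset.prod_eq_zero hi (by
          simp only [edgeVar, if_neg hiT]
          exact zero_pow (Finsupp.mem_support_iff.1 hi))
      have hne : s ≠ m := fun h => hs (h ▸ hm)
      rw [h0, mul_zero, coeff_zero, coeff_monomial, if_neg hne]
  | add p q hp hq => rw [map_add, coeff_add, coeff_add, hp, hq]

end Representation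

/-! ### Elements of `ℬ_l(n,k)` -/

section Elements

variable (n k : ℕ)

/-- The image in `ℬ_l(n,k)` of a generator. -/
noncomputable abbrev gen (g : OSGen n) : OSAlgL n k := RingQuot.mkRingHom (OSRelL n k) (og g)

/-- The idempotent at `x`. -/
noncomputable abbrev idem (x : Finset (Fin n)) : OSAlgL n k := gen n k (OSGen.I x)

/-- The move of a dot along the edge `ℓ`, to the right for `true` and to the left for `false`. -/
def move (c : Fin n × Bool) (x : Finset (Fin n)) : Finset (Fin n) :=
  if c.2 then moveRL n c.1 x else moveLL n c.1 x

/-- The move `c` is possible at `x`. -/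
def Valid (c : Fin n × Bool) (x : Finset (Fin n)) : Prop :=
  if c.2 then ValidRL n k c.1 x else ValidLL n k c.1 x

/-- The generator of the path algebra for the move `c` at `x`. -/
def arrowGen (c : Fin n × Bool) (x : Finset (Fin n)) : OSGen n :=
  if c.2 then OSGen.R c.1 x else OSGen.L c.1 x

/-- The sum over all vertices of the arrows for the move `c`. -/
noncomputable def arrow (c : Fin n × Bool) : OSAlgL n k := ∑ x, gen n k (arrowGen n c x)

/-- The total element `U_j` in `ℬ_l(n,k)`. -/
noncomputable def loop (j : Fin n) : OSAlgL n k := RingQuot.mkRingHom (OSRelL n k) (totUL n k j)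

variable {n k}

lemma mk_rel {a b : FreeAlgebra ℤ (OSGen n)} (h : OSRelL n k a b) :
    RingQuot.mkRingHom (OSRelL n k) a = RingQuot.mkRingHom (OSRelL n k) b :=
  RingQuot.mkRingHom_rel h

lemma idem_mul_self (x : Finset (Fin n)) : idem n k x * idem n k x = idem n k x := by
  have := mk_rel (OSRelL.idem_mul (k := k) x x)
  rwa [map_mul, if_pos rfl] at this

lemma idem_mul_of_ne {x y : Finset (Fin n)} (h : x ≠ y) : idem n k x * idem n k y = 0 := by
  have := mk_rel (OSRelL.idem_mul (k := k) x y)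
  rwa [map_mul, if_neg h, map_zero] at this

lemma idem_eq_zero {x : Finset (Fin n)} (h : x.card ≠ k) : idem n k x = 0 := by
  have := mk_rel (OSRelL.idem_junk (k := k) x h)
  rwa [map_zero] at this

lemma sum_idem : ∑ x : Finset (Fin n), idem n k x = 1 := by
  have := mk_rel (OSRelL.idem_sum (n := n) (k := k))
  rw [map_sum, map_one] at this
  rw [← this, Finset.sum_filter]
  refine Finset.sum_congr rfl fun x _ => ?_
  split_ifs with h
  · rfl
  · exact idem_eq_zero h

lemma ext_idem {a b : OSAlgL n k} (h : ∀ x, idem n k x * a = idem n k x * b) : a = b := by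
  rw [← one_mul a, ← one_mul b, ← sum_idem, Finset.sum_mul, Finset.sum_mul]
  exact Finset.sum_congr rfl fun x _ => h x

/-- An element supported at the vertex `x` on the left is recovered from a total sum. -/
lemma idem_mul_sum {g : Finset (Fin n) → OSAlgL n k} (hg : ∀ x, idem n k x * g x = g x)
    (x : Finset (Fin n)) : idem n k x * ∑ y, g y = g x := by
  rw [Finset.mul_sum, Finset.sum_eq_single x, hg]
  · intro y _ hy
    rw [← hg y, ← mul_assoc, idem_mul_of_ne hy.symm, zero_mul]
  · simp

lemma idem_mul_arrowGen (c : Fin n × Bool) (x : Finset (Fin n)) :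
    idem n k x * gen n k (arrowGen n c x) = gen n k (arrowGen n c x) := by
  obtain ⟨ℓ, _ | _⟩ := c
  · have := mk_rel (OSRelL.L_src (k := k) ℓ x)
    rwa [map_mul] at this
  · have := mk_rel (OSRelL.R_src (k := k) ℓ x)
    rwa [map_mul] at this

lemma arrowGen_mul_idem (c : Fin n × Bool) (x : Finset (Fin n)) :
    gen n k (arrowGen n c x) * idem n k (move n c x) = gen n k (arrowGen n c x) := by
  obtain ⟨ℓ, _ | _⟩ := c
  · have := mk_rel (OSRelL.L_tgt (k := k) ℓ x)
    rwa [map_mul] at this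
  · have := mk_rel (OSRelL.R_tgt (k := k) ℓ x)
    rwa [map_mul] at this

lemma arrowGen_eq_zero {c : Fin n × Bool} {x : Finset (Fin n)} (h : ¬ Valid n k c x) :
    gen n k (arrowGen n c x) = 0 := by
  obtain ⟨ℓ, _ | _⟩ := c
  · have := mk_rel (OSRelL.L_junk ℓ x h)
    rwa [map_zero] at this
  · have := mk_rel (OSRelL.R_junk ℓ x h)
    rwa [map_zero] at this

lemma idem_mul_arrow (c : Fin n × Bool) (x : Finset (Fin n)) :
    idem n k x * arrow n k c = gen n k (arrowGen n c x) :=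
  idem_mul_sum (idem_mul_arrowGen c) x

lemma idem_mul_arrow_mul_idem (c : Fin n × Bool) (x : Finset (Fin n)) :
    idem n k x * arrow n k c * idem n k (move n c x) = idem n k x * arrow n k c := by
  rw [idem_mul_arrow, arrowGen_mul_idem]

lemma idem_mul_arrow_of_not_valid {c : Fin n × Bool} {x : Finset (Fin n)} (h : ¬ Valid n k c x) :
    idem n k x * arrow n k c = 0 := by
  rw [idem_mul_arrow, arrowGen_eq_zero h]

lemma idem_mul_arrow_mul_arrow (c d : Fin n × Bool) (x : Finset (Fin n)) :
    idem n k x * (arrow n k c * arrow n k d) =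
      gen n k (arrowGen n c x) * gen n k (arrowGen n d (move n c x)) := by
  rw [← mul_assoc, idem_mul_arrow, ← arrowGen_mul_idem, mul_assoc, idem_mul_arrow,
    arrowGen_mul_idem]

/-! #### Relations between the total elements -/

/-- The edges `i` and `j` are disjoint. -/
def Distant (i j : Fin n) : Prop := (i : ℕ) + 1 < (j : ℕ) ∨ (j : ℕ) + 1 < (i : ℕ)

lemma Distant.symm {i j : Fin n} (h : Distant i j) : Distant j i := Or.symm h

lemma valid_swap {c d : Fin n × Bool} (h : Distant c.1 d.1) {x : Finset (Fin n)}
    (h1 : Valid n k c x) (h2 : Valid n k d (move n c x)) :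
    Valid n k d x ∧ Valid n k c (move n d x) := by
  obtain ⟨i, _ | _⟩ := c <;> obtain ⟨j, _ | _⟩ := d
  · exact ⟨(validLL_moveLL_distant h h1 h2).1, (validLL_moveLL_distant h h1 h2).2.1⟩
  · exact ⟨(validRL_moveLL_distant h h1 h2).1, (validRL_moveLL_distant h h1 h2).2.1⟩
  · exact validLL_moveRL_distant h h1 h2
  · exact ⟨(validRL_moveRL_distant h h1 h2).1, (validRL_moveRL_distant h h1 h2).2.1⟩

lemma arrowGen_comm {c d : Fin n × Bool} (h : Distant c.1 d.1) {x : Finset (Fin n)}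
    (h1 : Valid n k c x) (h2 : Valid n k d (move n c x)) :
    gen n k (arrowGen n c x) * gen n k (arrowGen n d (move n c x)) =
      gen n k (arrowGen n d x) * gen n k (arrowGen n c (move n d x)) := by
  obtain ⟨h3, h4⟩ := valid_swap h h1 h2
  obtain ⟨i, _ | _⟩ := c <;> obtain ⟨j, _ | _⟩ := d
  · have := mk_rel (OSRelL.LL_comm i j x h h1 h2)
    rwa [map_mul, map_mul] at this
  · have := mk_rel (OSRelL.LR_comm i j x h h1 h2)
    rwa [map_mul, map_mul] at this
  · have := mk_rel (OSRelL.LR_comm j i x h.symm h3 h4)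
    rw [map_mul, map_mul] at this
    exact this.symm
  · have := mk_rel (OSRelL.RR_comm i j x h h1 h2)
    rwa [map_mul, map_mul] at this

lemma commute_arrow {c d : Fin n × Bool} (h : Distant c.1 d.1) :
    Commute (arrow n k c) (arrow n k d) := by
  refine ext_idem fun x => ?_
  rw [idem_mul_arrow_mul_arrow, idem_mul_arrow_mul_arrow]
  by_cases h1 : Valid n k c x ∧ Valid n k d (move n c x)
  · exact arrowGen_comm h h1.1 h1.2
  by_cases h2 : Valid n k d x ∧ Valid n k c (move n d x)
  · exact (arrowGen_comm h.symm h2.1 h2.2).symm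
  have key : ∀ c d : Fin n × Bool, ¬ (Valid n k c x ∧ Valid n k d (move n c x)) →
      gen n k (arrowGen n c x) * gen n k (arrowGen n d (move n c x)) = 0 := by
    intro c d h
    by_cases hc : Valid n k c x
    · rw [arrowGen_eq_zero (fun hd => h ⟨hc, hd⟩), mul_zero]
    · rw [arrowGen_eq_zero hc, zero_mul]
  rw [key _ _ h1, key _ _ h2]

/-- One dot cannot cross two edges in a row. -/
lemma arrow_mul_arrow_eq_zero {i j : Fin n} {b : Bool}
    (h : if b then (j : ℕ) = i + 1 else (i : ℕ) = j + 1) :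
    arrow n k (i, b) * arrow n k (j, b) = 0 := by
  refine ext_idem fun x => ?_
  rw [idem_mul_arrow_mul_arrow, mul_zero]
  cases b
  · have := mk_rel (OSRelL.LL_zero (k := k) i j x h)
    rwa [map_mul, map_zero] at this
  · have := mk_rel (OSRelL.RR_zero (k := k) i j x h)
    rwa [map_mul, map_zero] at this

lemma loop_eq (j : Fin n) : loop n k j = ∑ x, gen n k (OSGen.U j x) := by
  rw [loop, totUL, map_sum, Finset.sum_filter]
  refine Finset.sum_congr rfl fun x _ => ?_
  split_ifs with h
  · rfl
  · have := mk_rel (OSRelL.U_junk j x h)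
    rw [map_zero] at this
    exact this.symm

lemma idem_mul_U (j : Fin n) (x : Finset (Fin n)) :
    idem n k x * gen n k (OSGen.U j x) = gen n k (OSGen.U j x) := by
  have := mk_rel (OSRelL.U_src (k := k) j x)
  rwa [map_mul] at this

lemma U_mul_idem (j : Fin n) (x : Finset (Fin n)) :
    gen n k (OSGen.U j x) * idem n k x = gen n k (OSGen.U j x) := by
  have := mk_rel (OSRelL.U_tgt (k := k) j x)
  rwa [map_mul] at this

lemma idem_mul_loop (j : Fin n) (x : Finset (Fin n)) :
    idem n k x * loop n k j = gen n k (OSGen.U j x) := by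
  rw [loop_eq, idem_mul_sum (idem_mul_U j)]

lemma loop_mul_idem (j : Fin n) (x : Finset (Fin n)) :
    loop n k j * idem n k x = gen n k (OSGen.U j x) := by
  rw [loop_eq, Finset.sum_mul, Finset.sum_eq_single x, U_mul_idem]
  · intro y _ hy
    rw [← U_mul_idem, mul_assoc, idem_mul_of_ne hy, mul_zero]
  · simp

lemma commute_of_gen {z : OSAlgL n k} (h : ∀ g, Commute z (gen n k g)) (a : OSAlgL n k) :
    Commute z a := by
  obtain ⟨a, rfl⟩ := RingQuot.mkRingHom_surjective _ a
  induction a using FreeAlgebra.induction with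
  | grade0 r =>
    rw [eq_intCast (algebraMap ℤ (FreeAlgebra ℤ (OSGen n))), map_intCast]
    exact (Int.cast_commute r z).symm
  | grade1 g => exact h g
  | mul a b ha hb => rw [map_mul]; exact ha.mul_right hb
  | add a b ha hb => rw [map_add]; exact ha.add_right hb

lemma loop_commute (j : Fin n) (a : OSAlgL n k) : Commute (loop n k j) a := by
  refine commute_of_gen (fun g => ?_) a
  cases g with
  | I x => exact (loop_mul_idem j x).trans (idem_mul_loop j x).symm
  | R ℓ x =>
    have := mk_rel (OSRelL.U_comm_R (k := k) j ℓ x)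
    rwa [map_mul, map_mul] at this
  | L ℓ x =>
    have := mk_rel (OSRelL.U_comm_L (k := k) j ℓ x)
    rwa [map_mul, map_mul] at this
  | U ℓ x =>
    have := mk_rel (OSRelL.U_comm_U (k := k) j ℓ x)
    rwa [map_mul, map_mul] at this

/-- Crossing an edge forth and back is multiplication by the corresponding loop. -/
lemma idem_mul_arrow_mul_reverse {ℓ : Fin n} {b : Bool} {x : Finset (Fin n)}
    (h : Valid n k (ℓ, b) x) :
    idem n k x * (arrow n k (ℓ, b) * arrow n k (ℓ, !b)) = loop n k ℓ * idem n k x := by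
  rw [idem_mul_arrow_mul_arrow, loop_mul_idem]
  cases b
  · have h' : ValidLL n k ℓ x := h
    have := mk_rel (OSRelL.LR_eq_U (k := k) ℓ _ (validRL_moveLL h'))
    rwa [map_mul, moveRL_moveLL h'] at this
  · have := mk_rel (OSRelL.RL_eq_U (k := k) ℓ x h)
    rwa [map_mul] at this

lemma loop_mul_idem_eq_zero {ℓ : Fin n} {x : Finset (Fin n)} (h1 : Hole x ℓ)
    (h2 : Hole x (ℓ + 1)) : loop n k ℓ * idem n k x = 0 := by
  rw [loop_mul_idem]
  have := mk_rel (OSRelL.U_vanish (k := k) ℓ x (hole_val.1 h1) h2)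
  rwa [map_zero] at this

variable (n k) in
/-- Evaluation of polynomials at the total elements `U_j`. -/
noncomputable def evalLoop : MvPolynomial (Fin n) ℤ →+* OSAlgL n k :=
  (Subring.center (OSAlgL n k)).subtype.comp (MvPolynomial.eval₂Hom
    (Int.castRingHom (Subring.center (OSAlgL n k)))
    fun j => ⟨loop n k j, Subring.mem_center_iff.2 fun a => (loop_commute j a).eq.symm⟩)

lemma evalLoop_X (j : Fin n) : evalLoop n k (MvPolynomial.X j) = loop n k j := by
  simp [evalLoop]

lemma evalLoop_mem_center (p : MvPolynomial (Fin n) ℤ) :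
    evalLoop n k p ∈ Subring.center (OSAlgL n k) := by
  rw [evalLoop, RingHom.comp_apply]
  exact Subtype.prop _

lemma evalLoop_commute (p : MvPolynomial (Fin n) ℤ) (a : OSAlgL n k) :
    Commute (evalLoop n k p) a :=
  (Subring.mem_center_iff.1 (evalLoop_mem_center p) a).symm

end Elements

/-! ### Reduction of paths -/

section Paths

variable (n k : ℕ)

/-- The product of the total arrows along a sequence of moves. -/
noncomputable def word (w : List (Fin n × Bool)) : OSAlgL n k := (w.map (arrow n k)).prod

/-- The sequence of moves `w` leads from `x` to `y`. -/
def Path : Finset (Fin n) → List (Fin n × Bool) → Finset (Fin n) → Prop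
  | x, [], y => x = y
  | x, c :: w, y => Valid n k c x ∧ Path (move n c x) w y

open Classical in
/-- The number of dots of `x` at positions less than `j`. -/
noncomputable def dotCount (x : Finset (Fin n)) (j : ℕ) : ℤ :=
  ∑ q ∈ Finset.range j, if Hole x q then 0 else 1

variable {n k}

lemma word_nil : word n k [] = 1 := rfl

lemma word_cons (c : Fin n × Bool) (w : List (Fin n × Bool)) :
    word n k (c :: w) = arrow n k c * word n k w := by
  simp [word]

lemma word_append (v w : List (Fin n × Bool)) :
    word n k (v ++ w) = word n k v * word n k w := by
  simp [word]

lemma path_append {v w : List (Fin n × Bool)} {x z : Finset (Fin n)} :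
    Path n k x (v ++ w) z ↔ ∃ y, Path n k x v y ∧ Path n k y w z := by
  induction v generalizing x with
  | nil => simp [Path]
  | cons c v ih =>
    simp only [List.cons_append, Path, ih]
    constructor
    · rintro ⟨h, y, h1, h2⟩
      exact ⟨y, ⟨h, h1⟩, h2⟩
    · rintro ⟨y, ⟨h, h1⟩, h2⟩
      exact ⟨h, y, h1, h2⟩

lemma idem_mul_word_cons (c : Fin n × Bool) (w : List (Fin n × Bool)) (x : Finset (Fin n)) :
    idem n k x * word n k (c :: w) =
      idem n k x * arrow n k c * (idem n k (move n c x) * word n k w) := by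
  rw [word_cons, ← mul_assoc, ← mul_assoc, idem_mul_arrow_mul_idem]

lemma idem_mul_word (w : List (Fin n × Bool)) (x : Finset (Fin n)) :
    idem n k x * word n k w = 0 ∨
      ∃ y, Path n k x w y ∧ idem n k x * word n k w = idem n k x * word n k w * idem n k y := by
  induction w generalizing x with
  | nil => exact Or.inr ⟨x, rfl, by rw [word_nil, mul_one, idem_mul_self]⟩
  | cons c w ih =>
    by_cases hc : Valid n k c x
    · obtain h | ⟨y, h1, h2⟩ := ih (move n c x)
      · left
        rw [idem_mul_word_cons, h, mul_zero]
      · right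
        refine ⟨y, ⟨hc, h1⟩, ?_⟩
        rw [idem_mul_word_cons, mul_assoc _ _ (idem n k y), ← h2]
    · left
      rw [idem_mul_word_cons, idem_mul_arrow_of_not_valid hc, zero_mul]

lemma dotCount_succ (x : Finset (Fin n)) (j : ℕ) [Decidable (Hole x j)] :
    dotCount n x (j + 1) = dotCount n x j + if Hole x j then 0 else 1 := by
  rw [dotCount, Finset.sum_range_succ, ← dotCount]
  congr

lemma dotCount_move {ℓ : Fin n} {b : Bool} {x : Finset (Fin n)} (h : Valid n k (ℓ, b) x) (j : ℕ) :
    dotCount n (move n (ℓ, b) x) j =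
      dotCount n x j - if j = ℓ + 1 then (if b then 1 else -1) else 0 := by
  classical
  induction j with
  | zero => simp [dotCount]
  | succ j ih =>
    rw [dotCount_succ, dotCount_succ, ih]
    cases b
    · obtain ⟨-, h0, h1, h2⟩ := validLL_iff.1 (show ValidLL n k ℓ x from h)
      have h3 : Hole (move n (ℓ, false) x) j ↔ j ≠ ℓ ∧ (j = ℓ + 1 ∨ Hole x j) :=
        hole_moveLL h0 j
      simp only [h3]
      by_cases e1 : j = ℓ
      · subst e1; simp [h1]
      · by_cases e2 : j = ℓ + 1
        · subst e2; simp [h2]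
        · simp [e1, e2]
    · obtain ⟨-, h0, h1, h2⟩ := validRL_iff.1 (show ValidRL n k ℓ x from h)
      have h3 : Hole (move n (ℓ, true) x) j ↔ j ≠ ℓ + 1 ∧ (j = ℓ ∨ Hole x j) :=
        hole_moveRL h0 j
      simp only [h3]
      by_cases e1 : j = ℓ
      · subst e1; simp [h1]
      · by_cases e2 : j = ℓ + 1
        · subst e2; simp [h2]
        · simp [e1, e2]

lemma dotCount_of_not_mem {w : List (Fin n × Bool)} {x y : Finset (Fin n)} (h : Path n k x w y)
    {j : ℕ} (hj : ∀ c ∈ w, (c.1 : ℕ) ≠ j) : dotCount n y (j + 1) = dotCount n x (j + 1) := by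
  induction w generalizing x with
  | nil => rw [show x = y from h]
  | cons c w ih =>
    obtain ⟨h1, h2⟩ := h
    rw [ih h2 fun d hd => hj d (List.mem_cons_of_mem _ hd), dotCount_move h1, if_neg, sub_zero]
    have := hj c List.mem_cons_self
    omega

lemma dotCount_of_mem {w : List (Fin n × Bool)} (hw : (w.map Prod.fst).Nodup)
    {x y : Finset (Fin n)} (h : Path n k x w y) {ℓ : Fin n} {b : Bool} (hc : (ℓ, b) ∈ w) :
    dotCount n y (ℓ + 1) = dotCount n x (ℓ + 1) - if b then 1 else -1 := by
  obtain ⟨v, w, rfl⟩ := List.append_of_mem hc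
  obtain ⟨z, h1, h2, h3⟩ := path_append.1 h
  rw [List.map_append, List.map_cons, List.nodup_append, List.nodup_cons] at hw
  obtain ⟨-, ⟨hw1, -⟩, hw2⟩ := hw
  rw [dotCount_of_not_mem h3, dotCount_move h2, if_pos rfl, dotCount_of_not_mem h1]
  · intro c hc he
    exact hw2 c.1 (List.mem_map_of_mem hc) ℓ List.mem_cons_self (Fin.ext he)
  · intro c hc he
    exact hw1 (List.mem_map.2 ⟨c, hc, Fin.ext he⟩)

/-- A closed path which crosses every edge at most once is trivial. -/
lemma eq_nil_of_path {w : List (Fin n × Bool)} (hw : (w.map Prod.fst).Nodup)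
    {x : Finset (Fin n)} (h : Path n k x w x) : w = [] := by
  refine List.eq_nil_iff_forall_not_mem.2 fun ⟨ℓ, b⟩ hc => ?_
  have := dotCount_of_mem hw h hc
  cases b
  · simp at this
  · simp at this
    omega

/-- The edges of `a` split into those commuting with `i` and those commuting with `j`. -/
lemma arrow_mul_word_mul_arrow {c d : Fin n × Bool} (hcd : arrow n k c * arrow n k d = 0)
    {a : List (Fin n × Bool)} (low : Fin n → Prop)
    (h1 : ∀ e ∈ a, low e.1 → Distant e.1 d.1 ∧ ∀ f ∈ a, ¬ low f.1 → Distant e.1 f.1)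
    (h2 : ∀ e ∈ a, ¬ low e.1 → Distant c.1 e.1) :
    arrow n k c * word n k a * arrow n k d = 0 := by
  suffices ∀ u : OSAlgL n k, Commute u (arrow n k d) →
      (∀ f ∈ a, ¬ low f.1 → Commute u (arrow n k f)) →
      arrow n k c * u * word n k a * arrow n k d = 0 by
    simpa using this 1 (Commute.one_left _) fun _ _ _ => Commute.one_left _
  induction a with
  | nil =>
    intro u hu _
    rw [word_nil, mul_one, mul_assoc, hu.eq, ← mul_assoc, hcd, zero_mul]
  | cons e a ih =>
    intro u hu hu'
    have ih' := ih (fun e he hl => ⟨(h1 e (List.mem_cons_of_mem _ he) hl).1,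
        fun f hf => (h1 e (List.mem_cons_of_mem _ he) hl).2 f (List.mem_cons_of_mem _ hf)⟩)
      fun e he => h2 e (List.mem_cons_of_mem _ he)
    by_cases he : low e.1
    · obtain ⟨h3, h4⟩ := h1 e List.mem_cons_self he
      have := ih' (u * arrow n k e) (hu.mul_left (commute_arrow h3)) fun f hf hl =>
        (hu' f (List.mem_cons_of_mem _ hf) hl).mul_left
          (commute_arrow (h4 f (List.mem_cons_of_mem _ hf) hl))
      rw [word_cons]
      simpa only [mul_assoc] using this
    · have := ih' u hu fun f hf => hu' f (List.mem_cons_of_mem _ hf)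
      have h5 : Commute (arrow n k c) (arrow n k e) := commute_arrow (h2 e List.mem_cons_self he)
      have h6 := hu' e List.mem_cons_self he
      rw [word_cons, ← mul_assoc, mul_assoc (arrow n k c), h6.eq, ← mul_assoc, h5.eq]
      rw [mul_assoc (arrow n k e), mul_assoc (arrow n k e), mul_assoc (arrow n k e), this, mul_zero]

lemma commute_word {c : Fin n × Bool} {a : List (Fin n × Bool)}
    (h : ∀ e ∈ a, Distant c.1 e.1) : Commute (arrow n k c) (word n k a) := by
  induction a with
  | nil => exact Commute.one_right _
  | cons e a ih =>
    rw [word_cons]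
    exact (commute_arrow (h e List.mem_cons_self)).mul_right
      (ih fun e he => h e (List.mem_cons_of_mem _ he))

/-- Crossing an edge twice in the same direction gives zero. -/
lemma arrow_mul_word_mul_arrow_same {i : Fin n} {b : Bool} {a : List (Fin n × Bool)}
    (ha : (a.map Prod.fst).Nodup) (hi : ∀ c ∈ a, c.1 ≠ i) {x y : Finset (Fin n)}
    (hx : Valid n k (i, b) x) (hp : Path n k (move n (i, b) x) a y) (hy : Valid n k (i, b) y) :
    arrow n k (i, b) * word n k a * arrow n k (i, b) = 0 := by
  classical
  have hi' : ∀ c ∈ a, (c.1 : ℕ) ≠ i := fun c hc h => hi c hc (Fin.ext h)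
  have hD := dotCount_of_not_mem hp hi'
  obtain ⟨j, hj, hja⟩ : ∃ j : Fin n, (if b then (j : ℕ) = i + 1 else (i : ℕ) = j + 1) ∧
      (j, b) ∈ a := by
    cases b
    · obtain ⟨-, h0, h1, h2⟩ := validLL_iff.1 (show ValidLL n k i x from hx)
      obtain ⟨-, -, h3, h4⟩ := validLL_iff.1 (show ValidLL n k i y from hy)
      have h5 : ¬ Hole (move n (i, false) x) i := by
        rw [show move n (i, false) x = moveLL n i x from rfl, hole_moveLL h0]
        simp
      rw [dotCount_succ, dotCount_succ, if_pos h3, if_neg h5] at hD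
      obtain ⟨i, hin⟩ := i
      cases i with
      | zero => simp [dotCount] at hD
      | succ j =>
        refine ⟨⟨j, by omega⟩, by simp, ?_⟩
        by_contra hcon
        by_cases hm : ∃ c ∈ a, (c.1 : ℕ) = j
        · obtain ⟨⟨ℓ, b⟩, hc, rfl⟩ := hm
          cases b
          · exact hcon hc
          · have := dotCount_of_mem ha hp hc
            simp at this hD
            omega
        · push Not at hm
          have := dotCount_of_not_mem hp hm
          simp at this hD
          omega
    · obtain ⟨-, h0, h1, h2⟩ := validRL_iff.1 (show ValidRL n k i x from hx)
      obtain ⟨-, -, h3, h4⟩ := validRL_iff.1 (show ValidRL n k i y from hy)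
      have h5 : ¬ Hole (move n (i, true) x) (i + 1) := by
        rw [show move n (i, true) x = moveRL n i x from rfl, hole_moveRL h0]
        simp
      refine ⟨⟨i + 1, h0⟩, by simp, ?_⟩
      have e1 := dotCount_succ y (i + 1)
      have e2 := dotCount_succ (move n (i, true) x) (i + 1)
      rw [if_pos h4] at e1
      rw [if_neg h5] at e2
      by_contra hcon
      by_cases hm : ∃ c ∈ a, (c.1 : ℕ) = i + 1
      · obtain ⟨⟨ℓ, b⟩, hc, h6⟩ := hm
        obtain rfl : ℓ = ⟨i + 1, h0⟩ := Fin.ext h6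
        cases b
        · have := dotCount_of_mem ha hp hc
          simp at this
          omega
        · exact hcon hc
      · push Not at hm
        have := dotCount_of_not_mem hp hm
        omega
  obtain ⟨v, w, rfl⟩ := List.append_of_mem hja
  rw [List.map_append, List.map_cons, List.nodup_append] at ha
  have hv : ∀ c ∈ v, (c.1 : ℕ) ≠ j := fun c hc he =>
    ha.2.2 c.1 (List.mem_map_of_mem hc) j List.mem_cons_self (Fin.ext he)
  have hvi : ∀ c ∈ v, (c.1 : ℕ) ≠ i := fun c hc => hi' c (List.mem_append_left _ hc)
  have key : arrow n k (i, b) * word n k v * arrow n k (j, b) = 0 := by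
    refine arrow_mul_word_mul_arrow (arrow_mul_arrow_eq_zero hj)
      (fun e => if b then (e : ℕ) < i else (i : ℕ) < e) ?_ ?_
    · intro e he hl
      have := hv e he
      have := hvi e he
      refine ⟨?_, fun f hf hl' => ?_⟩
      · cases b <;> simp [Distant] at * <;> omega
      · have := hv f hf
        have := hvi f hf
        cases b <;> simp [Distant] at * <;> omega
    · intro e he hl
      have := hv e he
      have := hvi e he
      cases b <;> simp [Distant] at * <;> omega
  rw [word_append, word_cons, ← mul_assoc, ← mul_assoc, key, zero_mul, zero_mul]

/-- Between two crossings of an edge in opposite directions, no adjacent edge is crossed. -/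
lemma distant_of_path {i : Fin n} {b : Bool} {a : List (Fin n × Bool)}
    (ha : (a.map Prod.fst).Nodup) (hi : ∀ c ∈ a, c.1 ≠ i) {x y : Finset (Fin n)}
    (hx : Valid n k (i, b) x) (hp : Path n k (move n (i, b) x) a y) (hy : Valid n k (i, !b) y) :
    ∀ c ∈ a, Distant i c.1 := by
  classical
  have hi' : ∀ c ∈ a, (c.1 : ℕ) ≠ i := fun c hc h => hi c hc (Fin.ext h)
  have hD := dotCount_of_not_mem hp hi'
  have h0 : (i : ℕ) + 1 < n := by
    cases b
    · exact hx.2.1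
    · exact hx.2.1
  have hh : (Hole (move n (i, b) x) i ↔ Hole y i) ∧
      (Hole (move n (i, b) x) (i + 1) ↔ Hole y (i + 1)) := by
    cases b
    · obtain ⟨-, -, h3, h4⟩ := validRL_iff.1 (show ValidRL n k i y from hy)
      rw [show move n (i, false) x = moveLL n i x from rfl, hole_moveLL h0, hole_moveLL h0]
      simp [h3, h4]
    · obtain ⟨-, -, h3, h4⟩ := validLL_iff.1 (show ValidLL n k i y from hy)
      rw [show move n (i, true) x = moveRL n i x from rfl, hole_moveRL h0, hole_moveRL h0]
      simp [h3, h4]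
  have e1 : dotCount n y i = dotCount n (move n (i, b) x) i := by
    rw [dotCount_succ, dotCount_succ] at hD
    simp only [hh.1] at hD
    omega
  have e2 : dotCount n y (i + 1 + 1) = dotCount n (move n (i, b) x) (i + 1 + 1) := by
    rw [dotCount_succ _ (i + 1), dotCount_succ _ (i + 1), hD]
    simp only [hh.2]
  rintro ⟨ℓ, b'⟩ hc
  have h3 := dotCount_of_mem ha hp hc
  have h4 := hi' _ hc
  by_contra hcon
  simp only [Distant] at hcon h4
  obtain h5 | h5 : (i : ℕ) = ℓ + 1 ∨ (ℓ : ℕ) = i + 1 := by omega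
  · rw [← h5] at h3
    cases b' <;> simp at h3 <;> omega
  · rw [h5] at h3
    cases b' <;> simp at h3 <;> omega

/-- Every path is a multiple of a path crossing every edge at most once. -/
lemma exists_reduced (w : List (Fin n × Bool)) (x : Finset (Fin n)) :
    ∃ (p : MvPolynomial (Fin n) ℤ) (w' : List (Fin n × Bool)), (w'.map Prod.fst).Nodup ∧
      idem n k x * word n k w = evalLoop n k p * (idem n k x * word n k w') := by
  induction w generalizing x with
  | nil => exact ⟨1, [], by simp, by simp⟩
  | cons c v ih =>
    have hzero : ∀ z : OSAlgL n k, z = 0 → ∃ (p : MvPolynomial (Fin n) ℤ)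
        (w' : List (Fin n × Bool)), (w'.map Prod.fst).Nodup ∧
        z = evalLoop n k p * (idem n k x * word n k w') :=
      fun z hz => ⟨0, [], by simp, by simp [hz]⟩
    obtain ⟨p, w, hw, hp⟩ := ih (move n c x)
    have hp' : idem n k x * word n k (c :: v) =
        evalLoop n k p * (idem n k x * word n k (c :: w)) := by
      rw [idem_mul_word_cons, hp, idem_mul_word_cons, ← mul_assoc,
        ← (evalLoop_commute p _).eq, mul_assoc]
    rw [hp']
    suffices ∃ (q : MvPolynomial (Fin n) ℤ) (w' : List (Fin n × Bool)), (w'.map Prod.fst).Nodup ∧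
        idem n k x * word n k (c :: w) = evalLoop n k q * (idem n k x * word n k w') by
      obtain ⟨q, w', h1, h2⟩ := this
      exact ⟨p * q, w', h1, by rw [h2, map_mul, mul_assoc]⟩
    by_cases hc : c.1 ∈ w.map Prod.fst
    swap
    · exact ⟨1, c :: w, by rw [List.map_cons, List.nodup_cons]; exact ⟨hc, hw⟩, by simp⟩
    obtain h | ⟨y, hy, -⟩ := idem_mul_word (k := k) (c :: w) x
    · exact hzero _ h
    obtain ⟨i, b⟩ := c
    obtain ⟨⟨_, b'⟩, h1, rfl⟩ := List.mem_map.1 hc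
    obtain ⟨a, r, rfl⟩ := List.append_of_mem h1
    rename_i i
    obtain ⟨h2, h3⟩ := hy
    obtain ⟨z, h4, h5, h6⟩ := path_append.1 h3
    rw [List.map_append, List.map_cons] at hw
    have hw' := List.nodup_append.1 hw
    have hia : ∀ c ∈ a, c.1 ≠ i := fun c hc => hw'.2.2 c.1 (List.mem_map_of_mem hc) i
      List.mem_cons_self
    by_cases hb : b' = b
    · subst hb
      refine hzero _ ?_
      have := arrow_mul_word_mul_arrow_same hw'.1 hia h2 h4 h5
      rw [word_cons, word_append, word_cons, ← mul_assoc (arrow n k _),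
        ← mul_assoc (arrow n k _ * _),
        this, zero_mul, mul_zero]
    · obtain rfl : b' = !b := by cases b <;> cases b' <;> simp_all
      refine ⟨MvPolynomial.X i, a ++ r, ?_, ?_⟩
      · rw [List.map_append]
        exact hw.sublist (List.Sublist.append_left (List.sublist_cons_self _ _) _)
      · have h7 : Commute (arrow n k (i, !b)) (word n k a) :=
          commute_word (distant_of_path hw'.1 hia h2 h4 h5)
        rw [word_cons, word_append, word_cons, ← mul_assoc (word n k a), ← h7.eq, evalLoop_X,
          word_append, ← mul_assoc (loop n k i), ← idem_mul_arrow_mul_reverse h2]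
        simp only [mul_assoc]

/-- Paths span the algebra over the polynomials in the `U_j`. -/
lemma mem_span_paths (a : OSAlgL n k) :
    a ∈ AddSubgroup.closure {z : OSAlgL n k | ∃ p x w,
      z = evalLoop n k p * (idem n k x * word n k w)} := by
  set N := AddSubgroup.closure {z : OSAlgL n k | ∃ p x w,
      z = evalLoop n k p * (idem n k x * word n k w)} with hN
  have hmem : ∀ p x w, evalLoop n k p * (idem n k x * word n k w) ∈ N := fun p x w =>
    AddSubgroup.subset_closure ⟨p, x, w, rfl⟩
  have hgen : ∀ p x w g, evalLoop n k p * (idem n k x * word n k w) * gen n k g ∈ N := by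
    intro p x w g
    obtain h | ⟨y, -, h⟩ := idem_mul_word (k := k) w x
    · rw [h, mul_zero, zero_mul]
      exact N.zero_mem
    have hidem : ∀ y', evalLoop n k p * (idem n k x * word n k w) * idem n k y' ∈ N := by
      intro y'
      rw [h]
      by_cases hy : y = y'
      · subst hy
        rw [mul_assoc, mul_assoc _ (idem n k y), idem_mul_self, ← h]
        exact hmem _ _ _
      · rw [mul_assoc, mul_assoc _ (idem n k y), idem_mul_of_ne hy, mul_zero, mul_zero]
        exact N.zero_mem
    have hcases : ∀ y', evalLoop n k p * (idem n k x * word n k w) * idem n k y' = 0 ∨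
        evalLoop n k p * (idem n k x * word n k w) * idem n k y' =
          evalLoop n k p * (idem n k x * word n k w) := by
      intro y'
      rw [h]
      by_cases hy : y = y'
      · subst hy
        right
        rw [mul_assoc, mul_assoc _ (idem n k y), idem_mul_self]
      · left
        rw [mul_assoc, mul_assoc _ (idem n k y), idem_mul_of_ne hy, mul_zero, mul_zero]
    have harrow : ∀ c y', evalLoop n k p * (idem n k x * word n k w) *
        gen n k (arrowGen n c y') ∈ N := by
      intro c y'
      rw [← idem_mul_arrow, ← mul_assoc]
      obtain h' | h' := hcases y'
      · rw [h', zero_mul]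
        exact N.zero_mem
      · have := hmem p x (w ++ [c])
        rw [word_append, word_cons, word_nil, mul_one] at this
        rw [h']
        simpa only [mul_assoc] using this
    cases g with
    | I y' => exact hidem y'
    | R ℓ y' => exact harrow (ℓ, true) y'
    | L ℓ y' => exact harrow (ℓ, false) y'
    | U ℓ y' =>
      rw [← idem_mul_loop, ← mul_assoc]
      obtain h' | h' := hcases y'
      · rw [h', zero_mul]
        exact N.zero_mem
      · rw [h', ← (loop_commute ℓ _).eq, ← evalLoop_X, ← mul_assoc, ← map_mul]
        exact hmem _ _ _
  have hgen' : ∀ g, ∀ z ∈ N, z * gen n k g ∈ N := by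
    intro g z hz
    induction hz using AddSubgroup.closure_induction with
    | mem z hz =>
      obtain ⟨p, x, w, rfl⟩ := hz
      exact hgen p x w g
    | zero => rw [zero_mul]; exact N.zero_mem
    | add y z _ _ hy hz => rw [add_mul]; exact N.add_mem hy hz
    | neg z _ hz => exact (neg_mul z (gen n k g)).symm ▸ N.neg_mem hz
  have hall : ∀ a : FreeAlgebra ℤ (OSGen n), ∀ z ∈ N,
      z * RingQuot.mkRingHom (OSRelL n k) a ∈ N := by
    intro a
    induction a using FreeAlgebra.induction with
    | grade0 r =>
      intro z hz
      rw [eq_intCast (algebraMap ℤ (FreeAlgebra ℤ (OSGen n))), map_intCast, ← (Int.cast_commute r z).eq,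
        ← zsmul_eq_mul]
      exact N.zsmul_mem hz r
    | grade1 g => exact hgen' g
    | mul a b ha hb =>
      intro z hz
      rw [map_mul, ← mul_assoc]
      exact hb _ (ha z hz)
    | add a b ha hb =>
      intro z hz
      rw [map_add, mul_add]
      exact N.add_mem (ha z hz) (hb z hz)
  have hone : (1 : OSAlgL n k) ∈ N := by
    rw [← sum_idem]
    refine N.sum_mem fun x _ => ?_
    simpa [word_nil] using hmem 1 x []
  obtain ⟨a, rfl⟩ := RingQuot.mkRingHom_surjective _ a
  simpa using hall a 1 hone

/-- The endomorphisms of a vertex are polynomials in the `U_j`. -/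
lemma exists_idem_mul_mul_idem (a : OSAlgL n k) (x : Finset (Fin n)) :
    ∃ p, idem n k x * a * idem n k x = evalLoop n k p * idem n k x := by
  induction mem_span_paths a using AddSubgroup.closure_induction with
  | mem z hz =>
    obtain ⟨p, y, w, rfl⟩ := hz
    by_cases hxy : x = y
    swap
    · refine ⟨0, ?_⟩
      rw [← mul_assoc, ← (evalLoop_commute p _).eq, mul_assoc (evalLoop n k p),
        ← mul_assoc (idem n k x),
        idem_mul_of_ne hxy]
      simp
    subst hxy
    obtain ⟨q, w', hw', h⟩ := exists_reduced (k := k) w x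
    rw [← mul_assoc, ← (evalLoop_commute p _).eq, mul_assoc (evalLoop n k p),
      ← mul_assoc (idem n k x),
      idem_mul_self, h, ← mul_assoc (evalLoop n k p), ← map_mul]
    obtain h0 | ⟨y, hy, h1⟩ := idem_mul_word (k := k) w' x
    · exact ⟨0, by simp [h0]⟩
    by_cases hxy : y = x
    · subst hxy
      obtain rfl := eq_nil_of_path hw' hy
      exact ⟨p * q, by rw [word_nil, mul_one, mul_assoc, idem_mul_self]⟩
    · refine ⟨0, ?_⟩
      rw [h1, mul_assoc, mul_assoc _ (idem n k y), idem_mul_of_ne hxy]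
      simp
  | zero => exact ⟨0, by simp⟩
  | add y z _ _ hy hz =>
    obtain ⟨p, hp⟩ := hy
    obtain ⟨q, hq⟩ := hz
    exact ⟨p + q, by rw [mul_add, add_mul, hp, hq, map_add, add_mul]⟩
  | neg z _ hz =>
    obtain ⟨p, hp⟩ := hz
    refine ⟨-p, (congrArg (· * idem n k x) (mul_neg (idem n k x) z)).trans ?_⟩
    refine (neg_mul (idem n k x * z) (idem n k x)).trans ?_
    rw [hp, map_neg]
    exact (neg_mul _ _).symm

end Paths

/-! ### The center of `ℬ_l(n,k)` -/

section Center

open MvPolynomial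

variable {n k : ℕ}

lemma evalLoop_monomial_single_add (m : Fin n →₀ ℕ) (ℓ : Fin n) :
    evalLoop n k (monomial (m + Finsupp.single ℓ 1) 1) =
      evalLoop n k (monomial m 1) * loop n k ℓ := by
  rw [← evalLoop_X, ← map_mul, X, monomial_mul, mul_one]

lemma exists_eq_add_single {m : Fin n →₀ ℕ} {ℓ : Fin n} (h : ℓ ∈ m.support) :
    ∃ m' : Fin n →₀ ℕ, m = m' + Finsupp.single ℓ 1 :=
  ⟨m - Finsupp.single ℓ 1, (tsub_add_cancel_of_le (Finsupp.single_le_iff.2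
    (Nat.one_le_iff_ne_zero.2 (Finsupp.mem_support_iff.1 h)))).symm⟩

lemma mem_support_of_add_single {m : Fin n →₀ ℕ} {ℓ e : Fin n} (he : e ≠ ℓ)
    (h : e ∈ (m + Finsupp.single ℓ 1).support) : e ∈ m.support := by
  rw [Finsupp.mem_support_iff] at h ⊢
  rwa [Finsupp.add_apply, Finsupp.single_eq_of_ne he, add_zero] at h

/-- A monomial containing all edges between two holes of `x` vanishes at `x`. -/
lemma evalLoop_monomial_mul_idem_of_holes (d : ℕ) :
    ∀ (m : Fin n →₀ ℕ) (x : Finset (Fin n)) (p : ℕ), Hole x p → Hole x (p + d + 1) →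
      p + d + 1 ≤ n → (∀ e : Fin n, p ≤ e → (e : ℕ) < p + d + 1 → e ∈ m.support) →
      evalLoop n k (monomial m 1) * idem n k x = 0 := by
  induction d with
  | zero =>
    intro m x p h1 h2 hn hm
    obtain ⟨m', rfl⟩ := exists_eq_add_single (hm ⟨p, by omega⟩ le_rfl (by simp))
    rw [evalLoop_monomial_single_add, mul_assoc, loop_mul_idem_eq_zero h1 h2, mul_zero]
  | succ d ih =>
    intro m x p h1 h2 hn hm
    by_cases hk : x.card = k
    swap
    · rw [idem_eq_zero hk, mul_zero]
    have hp : p < n := by omega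
    obtain ⟨m', rfl⟩ := exists_eq_add_single (hm ⟨p, hp⟩ le_rfl (by simp))
    rw [evalLoop_monomial_single_add, mul_assoc]
    by_cases h3 : Hole x (p + 1)
    · rw [loop_mul_idem_eq_zero h1 h3, mul_zero]
    have hv : Valid n k (⟨p, hp⟩, false) x :=
      validLL_iff.2 ⟨hk, by simp only; omega, h1, h3⟩
    have hzero : evalLoop n k (monomial m' 1) * idem n k (move n (⟨p, hp⟩, false) x) = 0 := by
      refine ih m' _ (p + 1) ?_ ?_ (by omega) fun e he he' => ?_
      · exact (hole_moveLL (by simp only; omega) _).2 ⟨by simp, Or.inl rfl⟩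
      · refine (hole_moveLL (by simp only; omega) _).2 ⟨by simp only; omega, Or.inr ?_⟩
        rwa [show p + 1 + d + 1 = p + (d + 1) + 1 by omega]
      · refine mem_support_of_add_single (fun h => ?_) (hm e (by omega) (by omega))
        rw [h] at he
        simp at he
    rw [← idem_mul_arrow_mul_reverse hv, ← mul_assoc (idem n k x), ← idem_mul_arrow_mul_idem,
      ← mul_assoc, ← mul_assoc, (evalLoop_commute _ _).eq, mul_assoc (idem n k x * _), hzero,
      mul_zero, zero_mul]

lemma evalLoop_monomial_mul_idem {m : Fin n →₀ ℕ} {x : Finset (Fin n)}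
    (h : ¬ Good m.support x) (a : ℤ) : evalLoop n k (monomial m a) * idem n k x = 0 := by
  unfold Good at h
  push Not at h
  obtain ⟨p, q, hpq, hq, h1, h2, h3⟩ := h
  obtain ⟨d, rfl⟩ := Nat.exists_eq_add_of_lt hpq
  rw [← mul_one a, ← C_mul_monomial, map_mul, mul_assoc,
    evalLoop_monomial_mul_idem_of_holes d m x p h1 h2 hq h3, mul_zero]

/-- At `x`, a polynomial acts through the coefficients of the monomials to which `x` is adapted. -/
lemma evalLoop_mul_idem_congr {p q : MvPolynomial (Fin n) ℤ} {x : Finset (Fin n)}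
    (h : ∀ m : Fin n →₀ ℕ, Good m.support x → coeff m p = coeff m q) :
    evalLoop n k p * idem n k x = evalLoop n k q * idem n k x := by
  have key : evalLoop n k (p - q) * idem n k x = 0 := by
    rw [(p - q).as_sum, map_sum, Finset.sum_mul]
    refine Finset.sum_eq_zero fun m _ => ?_
    by_cases hm : Good m.support x
    · rw [coeff_sub, h m hm, sub_self, map_zero, map_zero, zero_mul]
    · exact evalLoop_monomial_mul_idem hm _
  rw [← sub_add_cancel p q, map_add, add_mul, key, zero_add]

lemma rep_evalLoop (T : Finset (Fin n)) (p : MvPolynomial (Fin n) ℤ) :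
    rep k T (evalLoop n k p) = algebraMap _ _ (aeval (edgeVar T) p) := by
  suffices (rep k T).comp (evalLoop n k) =
      (algebraMap (MvPolynomial (Fin n) ℤ) (Module.End _ (AdaptedModule k T))).comp
        (aeval (edgeVar T) : MvPolynomial (Fin n) ℤ →ₐ[ℤ] _).toRingHom from
    RingHom.congr_fun this p
  refine ringHom_ext (fun r => ?_) fun j => ?_
  · rw [eq_intCast (C : ℤ →+* MvPolynomial (Fin n) ℤ)]
    exact (map_intCast _ r).trans (map_intCast _ r).symm
  · simp only [RingHom.comp_apply, evalLoop_X, loop, rep_mk, lift_genOp_totUL]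
    simp [Algebra.algebraMap_eq_smul_one]

lemma smul_elemOp {ι K : Type*} [CommRing K] {P : ι → Prop} (x y : ι) (c d : K) :
    c • elemOp P x y d = elemOp P x y (c * d) := by
  refine LinearMap.ext fun f => funext fun v => ?_
  rw [LinearMap.smul_apply, Pi.smul_apply, elemOp_apply, elemOp_apply]
  split_ifs <;> simp [mul_assoc]

/-- Elements of `ℬ_l(n,k)` acting on an adapted configuration detect coefficients. -/
lemma coeff_eq_of_evalLoop_mul {T x y : Finset (Fin n)} {g : OSAlgL n k}
    (hg : rep k T g = elemOp (Adapted k T) x y 1) (hx : Adapted k T x) (hy : Adapted k T y)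
    {p q : MvPolynomial (Fin n) ℤ} (h : evalLoop n k p * g = evalLoop n k q * g)
    {m : Fin n →₀ ℕ} (hm : m.support ⊆ T) : coeff m p = coeff m q := by
  have h1 := congrArg (rep k T) h
  rw [map_mul, map_mul, rep_evalLoop, rep_evalLoop, hg, ← Algebra.smul_def, ← Algebra.smul_def,
    smul_elemOp, smul_elemOp, mul_one, mul_one] at h1
  rw [← coeff_aeval_edgeVar p hm, ← coeff_aeval_edgeVar q hm, elemOp_injective hx hy h1]

lemma rep_idem (T x : Finset (Fin n)) : rep k T (idem n k x) = elemOp (Adapted k T) x x 1 := by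
  rw [rep_mk, FreeAlgebra.lift_ι_apply, genOp]

lemma rep_arrowGen_left {T x : Finset (Fin n)} {ℓ : Fin n} (hℓ : ℓ ∈ T) (hv : ValidLL n k ℓ x) :
    rep k T (gen n k (OSGen.L ℓ x)) = elemOp (Adapted k T) x (moveLL n ℓ x) 1 := by
  rw [rep_mk, FreeAlgebra.lift_ι_apply, genOp, if_pos hv, edgeInd, if_pos hℓ]

lemma mem_range_evalLoop {z : OSAlgL n k} (hz : z ∈ Subring.center (OSAlgL n k)) :
    ∃ p, evalLoop n k p = z := by
  classical
  have hz' : ∀ a, a * z = z * a := Subring.mem_center_iff.1 hz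
  have hp : ∀ x, ∃ p, z * idem n k x = evalLoop n k p * idem n k x := by
    intro x
    obtain ⟨p, hp⟩ := exists_idem_mul_mul_idem z x
    exact ⟨p, by rw [← hp, hz', mul_assoc, idem_mul_self]⟩
  choose p hp using hp
  have hinv : ∀ (m : Fin n →₀ ℕ) {x y : Finset (Fin n)}, x.card = k → y.card = k →
      Good m.support x → Good m.support y → coeff m (p x) = coeff m (p y) := by
    intro m x y
    refine eq_of_invariant (S := m.support) (fun x => coeff m (p x)) fun ℓ x hv hx => ?_
    have hmem : ℓ ∈ insert ℓ m.support := Finset.mem_insert_self _ _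
    have hxa : Adapted k (insert ℓ m.support) x := ⟨hv.1, hx⟩
    refine coeff_eq_of_evalLoop_mul (rep_arrowGen_left hmem hv) hxa (hxa.moveLL hv hmem) ?_
      (Finset.subset_insert _ _)
    set g := gen n k (OSGen.L ℓ x)
    have h1 : idem n k x * g = g := idem_mul_arrowGen (ℓ, false) x
    have h2 : g * idem n k (moveLL n ℓ x) = g := arrowGen_mul_idem (ℓ, false) x
    calc evalLoop n k (p (moveLL n ℓ x)) * g
        = g * (evalLoop n k (p (moveLL n ℓ x)) * idem n k (moveLL n ℓ x)) := by
          rw [(evalLoop_commute _ _).eq, (evalLoop_commute _ (idem n k _)).eq, ← mul_assoc, h2]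
      _ = z * g := by rw [← hp, ← hz' (idem n k _), ← mul_assoc, h2, hz']
      _ = evalLoop n k (p x) * g := by
          rw [← h1, ← mul_assoc, hp, mul_assoc]
  let c : (Fin n →₀ ℕ) → ℤ := fun m =>
    if h : ∃ x : Finset (Fin n), x.card = k ∧ Good m.support x then coeff m (p h.choose) else 0
  refine ⟨∑ m ∈ Finset.univ.biUnion fun x => (p x).support, monomial m (c m), ?_⟩
  refine ext_idem fun x => ?_
  rw [hz', hp, ← (evalLoop_commute _ _).eq]
  by_cases hx : x.card = k
  swap
  · rw [idem_eq_zero hx, mul_zero, mul_zero]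
  refine evalLoop_mul_idem_congr fun m hm => ?_
  have hc : c m = coeff m (p x) := by
    have h : ∃ x : Finset (Fin n), x.card = k ∧ Good m.support x := ⟨x, hx, hm⟩
    simp only [c, dif_pos h]
    exact hinv m h.choose_spec.1 hx h.choose_spec.2 hm
  simp only [coeff_sum, coeff_monomial, Finset.sum_ite_eq', hc, Finset.mem_biUnion,
    Finset.mem_univ, true_and]
  split_ifs with h
  · rfl
  · push Not at h
    exact (notMem_support_iff.1 (h x)).symm

lemma prod_X_eq_monomial (S : Finset (Fin n)) :
    ∃ s : Fin n →₀ ℕ, s.support = S ∧ (∀ i, s i ≤ 1) ∧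
      ∏ i ∈ S, (X i : MvPolynomial (Fin n) ℤ) = monomial s 1 := by
  classical
  have h : ∀ i, (∑ j ∈ S, Finsupp.single j 1) i = if i ∈ S then 1 else 0 := by
    intro i
    simp [Finsupp.finsetSum_apply, Finsupp.single_apply]
  refine ⟨∑ i ∈ S, Finsupp.single i 1, ?_, ?_, ?_⟩
  · ext i
    rw [Finsupp.mem_support_iff, h]
    simp
  · intro i
    rw [h]
    split_ifs <;> simp
  · rw [monomial_sum_one]
    rfl

lemma evalLoop_eq_zero {p : MvPolynomial (Fin n) ℤ} (hp : p ∈ squarefreeIdeal n k) :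
    evalLoop n k p = 0 := by
  suffices squarefreeIdeal n k ≤ RingHom.ker (evalLoop n k) from this hp
  refine Ideal.span_le.2 ?_
  rintro _ ⟨S, hS, rfl⟩
  rw [SetLike.mem_coe, RingHom.mem_ker]
  refine ext_idem fun x => ?_
  rw [mul_zero, ← (evalLoop_commute _ _).eq]
  by_cases hx : x.card = k
  · obtain ⟨s, hs, -, h⟩ := prod_X_eq_monomial S
    rw [h]
    refine evalLoop_monomial_mul_idem (fun hg => ?_) 1
    have := hg.card_le
    rw [hs] at this
    omega
  · rw [idem_eq_zero hx, mul_zero]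

lemma mem_squarefreeIdeal {p : MvPolynomial (Fin n) ℤ}
    (hp : ∀ m ∈ p.support, k + 1 ≤ m.support.card) : p ∈ squarefreeIdeal n k := by
  rw [p.as_sum]
  refine Ideal.sum_mem _ fun m hm => ?_
  obtain ⟨S, hSm, hS⟩ := Finset.exists_subset_card_eq (hp m hm)
  obtain ⟨s, hs, hs1, h⟩ := prod_X_eq_monomial S
  have hle : s ≤ m := by
    intro i
    by_cases hi : i ∈ S
    · exact (hs1 i).trans (Nat.one_le_iff_ne_zero.2 (Finsupp.mem_support_iff.1 (hSm hi)))
    · rw [← hs, Finsupp.notMem_support_iff] at hi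
      omega
  have : monomial m (coeff m p) = monomial (m - s) (coeff m p) * ∏ i ∈ S, X i := by
    rw [h, monomial_mul, mul_one, tsub_add_cancel_of_le hle]
  rw [this]
  exact Ideal.mul_mem_left _ _ (Ideal.subset_span ⟨S, hS, rfl⟩)

lemma mem_squarefreeIdeal_of_evalLoop (hk : k ≤ n) {p : MvPolynomial (Fin n) ℤ}
    (hp : evalLoop n k p = 0) : p ∈ squarefreeIdeal n k := by
  refine mem_squarefreeIdeal fun m hm => ?_
  by_contra hcard
  obtain ⟨T, hmT, hT⟩ := Finset.exists_superset_card_eq (s := m.support) (n := k) (by omega)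
    (by simpa using hk)
  refine mem_support_iff.1 hm ?_
  rw [← coeff_zero m]
  refine coeff_eq_of_evalLoop_mul (rep_idem T T) ⟨hT, good_self T⟩ ⟨hT, good_self T⟩ ?_ hmT
  rw [hp, map_zero]

theorem center_left (hk : k ≤ n) :
    ∃ φ : MvPolynomial (Fin n) ℤ ⧸ squarefreeIdeal n k →+* OSAlgL n k,
    Function.Injective φ ∧
    Set.range φ = (Subring.center (OSAlgL n k) : Set (OSAlgL n k)) ∧
    ∀ i : Fin n, φ (Ideal.Quotient.mk (squarefreeIdeal n k) (X i)) =
      RingQuot.mkRingHom (OSRelL n k) (totUL n k i) := by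
  refine ⟨Ideal.Quotient.lift _ (evalLoop n k) fun p => evalLoop_eq_zero, ?_, ?_, fun i => ?_⟩
  · exact RingHom.lift_injective_of_ker_le_ideal _ _ fun p hp =>
      mem_squarefreeIdeal_of_evalLoop hk hp
  · ext z
    constructor
    · rintro ⟨q, rfl⟩
      obtain ⟨p, rfl⟩ := Ideal.Quotient.mk_surjective q
      exact evalLoop_mem_center p
    · intro hz
      obtain ⟨p, rfl⟩ := mem_range_evalLoop hz
      exact ⟨Ideal.Quotient.mk _ p, rfl⟩
  · exact evalLoop_X i

end Center

/-! ### The reflection exchanging `ℬ_l(n,k)` and `ℬ_r(n,k)` -/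

section Reflection

variable {n k : ℕ}

/-- The reflection of a dot configuration. -/
def flip (x : Finset (Fin n)) : Finset (Fin n) := x.map Fin.revPerm.toEmbedding

lemma mem_flip {x : Finset (Fin n)} {i : Fin n} : i ∈ flip x ↔ i.rev ∈ x := by
  rw [flip, Finset.mem_map_equiv]
  rfl

lemma flip_flip (x : Finset (Fin n)) : flip (flip x) = x := by
  ext i
  rw [mem_flip, mem_flip, Fin.rev_rev]

lemma card_flip (x : Finset (Fin n)) : (flip x).card = x.card := Finset.card_map _

lemma flip_injective : Function.Injective (flip : Finset (Fin n) → Finset (Fin n)) :=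
  Function.LeftInverse.injective flip_flip

lemma prevFin_rev {ℓ : Fin n} (h : (ℓ : ℕ) + 1 < n) : prevFin ℓ.rev = (⟨ℓ + 1, h⟩ : Fin n).rev := by
  ext
  simp only [prevFin, Fin.val_rev]
  omega

lemma one_le_val_rev {ℓ : Fin n} : 1 ≤ (ℓ.rev : ℕ) ↔ (ℓ : ℕ) + 1 < n := by
  rw [Fin.val_rev]
  omega

lemma validLR_rev {ℓ : Fin n} {x : Finset (Fin n)} :
    ValidLR n k ℓ.rev (flip x) ↔ ValidRL n k ℓ x := by
  rw [ValidLR, ValidRL, card_flip, one_le_val_rev, mem_flip, Fin.rev_rev, mem_flip]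
  refine and_congr_right fun _ => ⟨fun ⟨h, h1, h2⟩ => ⟨h, h1, ?_⟩, fun ⟨h, h1, h2⟩ => ⟨h, h1, ?_⟩⟩
  · rwa [prevFin_rev h, Fin.rev_rev] at h2
  · rwa [prevFin_rev h, Fin.rev_rev]

lemma validRR_rev {ℓ : Fin n} {x : Finset (Fin n)} :
    ValidRR n k ℓ.rev (flip x) ↔ ValidLL n k ℓ x := by
  rw [ValidRR, ValidLL, card_flip, one_le_val_rev, mem_flip, mem_flip, Fin.rev_rev]
  refine and_congr_right fun _ => ⟨fun ⟨h, h1, h2⟩ => ⟨h, ?_, h2⟩, fun ⟨h, h1, h2⟩ => ⟨h, ?_, h2⟩⟩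
  · rwa [prevFin_rev h, Fin.rev_rev] at h1
  · rwa [prevFin_rev h, Fin.rev_rev]

lemma moveLR_rev {ℓ : Fin n} (h : (ℓ : ℕ) + 1 < n) (x : Finset (Fin n)) :
    moveLR n ℓ.rev (flip x) = flip (moveRL n ℓ x) := by
  ext i
  rw [moveLR, moveRL, dif_pos h, mem_flip, prevFin_rev h]
  simp only [Finset.mem_insert, Finset.mem_erase, mem_flip, ne_eq, ← Fin.rev_eq_iff]

lemma moveRR_rev {ℓ : Fin n} (h : (ℓ : ℕ) + 1 < n) (x : Finset (Fin n)) :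
    moveRR n ℓ.rev (flip x) = flip (moveLL n ℓ x) := by
  ext i
  rw [moveRR, moveLL, dif_pos h, mem_flip, prevFin_rev h]
  simp only [Finset.mem_insert, Finset.mem_erase, mem_flip, ne_eq, ← Fin.rev_eq_iff]

lemma validRL_rev {ℓ : Fin n} {x : Finset (Fin n)} :
    ValidRL n k ℓ.rev (flip x) ↔ ValidLR n k ℓ x := by
  rw [← validLR_rev, Fin.rev_rev, flip_flip]

lemma validLL_rev {ℓ : Fin n} {x : Finset (Fin n)} :
    ValidLL n k ℓ.rev (flip x) ↔ ValidRR n k ℓ x := by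
  rw [← validRR_rev, Fin.rev_rev, flip_flip]

lemma rev_val_add_one_lt {ℓ : Fin n} : (ℓ.rev : ℕ) + 1 < n ↔ 1 ≤ (ℓ : ℕ) := by
  rw [← one_le_val_rev, Fin.rev_rev]

lemma moveRL_rev {ℓ : Fin n} (h : 1 ≤ (ℓ : ℕ)) (x : Finset (Fin n)) :
    moveRL n ℓ.rev (flip x) = flip (moveLR n ℓ x) := by
  have := moveLR_rev (rev_val_add_one_lt.2 h) (flip x)
  rw [Fin.rev_rev, flip_flip] at this
  rw [this, flip_flip]

lemma moveLL_rev {ℓ : Fin n} (h : 1 ≤ (ℓ : ℕ)) (x : Finset (Fin n)) :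
    moveLL n ℓ.rev (flip x) = flip (moveRR n ℓ x) := by
  have := moveRR_rev (rev_val_add_one_lt.2 h) (flip x)
  rw [Fin.rev_rev, flip_flip] at this
  rw [this, flip_flip]

lemma validLR_moveRR {ℓ : Fin n} {x : Finset (Fin n)} (h : ValidRR n k ℓ x) :
    ValidLR n k ℓ (moveRR n ℓ x) ∧ moveLR n ℓ (moveRR n ℓ x) = x := by
  have h1 := validLL_rev.2 h
  rw [← validRL_rev, ← flip_injective.eq_iff, ← moveRL_rev h.2.1, ← moveLL_rev h.2.1]
  exact ⟨validRL_moveLL h1, moveRL_moveLL h1⟩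

lemma validRR_moveLR_distant {ℓ ℓ' : Fin n} {x : Finset (Fin n)}
    (hd : (ℓ : ℕ) + 1 < (ℓ' : ℕ) ∨ (ℓ' : ℕ) + 1 < (ℓ : ℕ))
    (h1 : ValidLR n k ℓ x) (h2 : ValidRR n k ℓ' (moveLR n ℓ x)) :
    ValidRR n k ℓ' x ∧ ValidLR n k ℓ (moveRR n ℓ' x) := by
  rw [← validLL_rev, ← moveRL_rev h1.2.1] at h2
  have := validLL_moveRL_distant (by simp only [Fin.val_rev]; omega) (validRL_rev.2 h1) h2
  have h3 := validLL_rev.1 this.1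
  rw [moveLL_rev h3.2.1, validRL_rev] at this
  exact ⟨h3, this.2⟩

/-- The reflection of a generator. -/
def flipGen : OSGen n → OSGen n
  | OSGen.I x => OSGen.I (flip x)
  | OSGen.R ℓ x => OSGen.L ℓ.rev (flip x)
  | OSGen.L ℓ x => OSGen.R ℓ.rev (flip x)
  | OSGen.U ℓ x => OSGen.U ℓ.rev (flip x)

lemma flipGen_flipGen (g : OSGen n) : flipGen (flipGen g) = g := by
  cases g <;> simp [flipGen, flip_flip]

variable (n) in
/-- The reflection on the free algebra on the generators. -/
noncomputable def flipHom : FreeAlgebra ℤ (OSGen n) →ₐ[ℤ] FreeAlgebra ℤ (OSGen n) :=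
  FreeAlgebra.lift ℤ fun g => og (flipGen g)

lemma flipHom_og (g : OSGen n) : flipHom n (og g) = og (flipGen g) :=
  FreeAlgebra.lift_ι_apply _ _

lemma sum_flip {A : Type*} [AddCommMonoid A] (f : Finset (Fin n) → A) :
    ∑ x ∈ Finset.univ.filter (fun x : Finset (Fin n) => x.card = k), f (flip x) =
      ∑ x ∈ Finset.univ.filter (fun x : Finset (Fin n) => x.card = k), f x :=
  Finset.sum_equiv ⟨flip, flip, flip_flip, flip_flip⟩ (by simp [card_flip]) fun _ _ => rfl

lemma flipHom_totUL (j : Fin n) : flipHom n (totUL n k j) = totUR n k j.rev := by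
  rw [totUL, map_sum, totUR, ← sum_flip (fun x => og (OSGen.U j.rev x))]
  exact Finset.sum_congr rfl fun x _ => flipHom_og _

lemma flipHom_totUR (j : Fin n) : flipHom n (totUR n k j) = totUL n k j.rev := flipHom_totUL j

lemma mk_mul_eq_of_rel_zero {A : Type*} [Ring A] {r : A → A → Prop} {a b b' : A} (h : r a 0) :
    RingQuot.mkRingHom r (a * b) = RingQuot.mkRingHom r (a * b') := by
  rw [map_mul, RingQuot.mkRingHom_rel h, map_mul, RingQuot.mkRingHom_rel h]
  simp

lemma mk_flipHom_of_relL ⦃a b : FreeAlgebra ℤ (OSGen n)⦄ (h : OSRelL n k a b) :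
    RingQuot.mkRingHom (OSRelR n k) (flipHom n a) =
      RingQuot.mkRingHom (OSRelR n k) (flipHom n b) := by
  induction h with
  | idem_mul x y =>
    have := RingQuot.mkRingHom_rel (OSRelR.idem_mul (k := k) (flip x) (flip y))
    simp only [flip_injective.eq_iff] at this
    split_ifs at this ⊢ <;> simpa only [map_mul, flipHom_og, map_zero, flipGen] using this
  | idem_sum =>
    have := RingQuot.mkRingHom_rel (OSRelR.idem_sum (n := n) (k := k))
    rw [← sum_flip] at this
    simpa only [map_sum, flipHom_og, map_one, flipGen] using this
  | idem_junk x h =>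
    simpa only [flipHom_og, map_zero, flipGen] using
      RingQuot.mkRingHom_rel (OSRelR.idem_junk (flip x) (by rwa [card_flip]))
  | R_junk ℓ x h =>
    simpa only [flipHom_og, map_zero, flipGen] using
      RingQuot.mkRingHom_rel (OSRelR.L_junk ℓ.rev (flip x) (by rwa [validLR_rev]))
  | L_junk ℓ x h =>
    simpa only [flipHom_og, map_zero, flipGen] using
      RingQuot.mkRingHom_rel (OSRelR.R_junk ℓ.rev (flip x) (by rwa [validRR_rev]))
  | U_junk ℓ x h =>
    simpa only [flipHom_og, map_zero, flipGen] using
      RingQuot.mkRingHom_rel (OSRelR.U_junk ℓ.rev (flip x) (by rwa [card_flip]))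
  | R_src ℓ x =>
    simpa only [map_mul, flipHom_og, flipGen] using
      RingQuot.mkRingHom_rel (OSRelR.L_src (k := k) ℓ.rev (flip x))
  | R_tgt ℓ x =>
    have := RingQuot.mkRingHom_rel (OSRelR.L_tgt (k := k) ℓ.rev (flip x))
    by_cases hv : ValidRL n k ℓ x
    · rw [moveLR_rev hv.lt] at this
      simpa only [map_mul, flipHom_og, flipGen] using this
    · rw [map_mul, flipHom_og, flipHom_og]
      refine Eq.trans ?_ this
      exact mk_mul_eq_of_rel_zero (OSRelR.L_junk _ _ (by rwa [validLR_rev]))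
  | L_src ℓ x =>
    simpa only [map_mul, flipHom_og, flipGen] using
      RingQuot.mkRingHom_rel (OSRelR.R_src (k := k) ℓ.rev (flip x))
  | L_tgt ℓ x =>
    have := RingQuot.mkRingHom_rel (OSRelR.R_tgt (k := k) ℓ.rev (flip x))
    by_cases hv : ValidLL n k ℓ x
    · rw [moveRR_rev hv.lt] at this
      simpa only [map_mul, flipHom_og, flipGen] using this
    · rw [map_mul, flipHom_og, flipHom_og]
      refine Eq.trans ?_ this
      exact mk_mul_eq_of_rel_zero (OSRelR.R_junk _ _ (by rwa [validRR_rev]))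
  | U_src ℓ x =>
    simpa only [map_mul, flipHom_og, flipGen] using
      RingQuot.mkRingHom_rel (OSRelR.U_src (k := k) ℓ.rev (flip x))
  | U_tgt ℓ x =>
    simpa only [map_mul, flipHom_og, flipGen] using
      RingQuot.mkRingHom_rel (OSRelR.U_tgt (k := k) ℓ.rev (flip x))
  | U_comm_R j ℓ x =>
    simpa only [map_mul, flipHom_og, flipHom_totUL, flipGen] using
      RingQuot.mkRingHom_rel (OSRelR.U_comm_L (k := k) j.rev ℓ.rev (flip x))
  | U_comm_L j ℓ x =>
    simpa only [map_mul, flipHom_og, flipHom_totUL, flipGen] using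
      RingQuot.mkRingHom_rel (OSRelR.U_comm_R (k := k) j.rev ℓ.rev (flip x))
  | U_comm_U j ℓ x =>
    simpa only [map_mul, flipHom_og, flipHom_totUL, flipGen] using
      RingQuot.mkRingHom_rel (OSRelR.U_comm_U (k := k) j.rev ℓ.rev (flip x))
  | RL_eq_U ℓ x h =>
    have := RingQuot.mkRingHom_rel (OSRelR.LR_eq_U ℓ.rev (flip (moveRL n ℓ x)) (by
      rw [validRR_rev]; exact validLL_moveRL h))
    rw [moveRR_rev h.lt, moveLL_moveRL h] at this
    simpa only [map_mul, flipHom_og, flipGen] using this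
  | LR_eq_U ℓ x h =>
    have := RingQuot.mkRingHom_rel (OSRelR.RL_eq_U ℓ.rev (flip (moveRL n ℓ x)) (by
      rw [validRR_rev]; exact validLL_moveRL h))
    rw [moveRR_rev h.lt, moveLL_moveRL h] at this
    simpa only [map_mul, flipHom_og, flipGen] using this
  | RR_comm ℓ ℓ' x hd h1 h2 =>
    have := RingQuot.mkRingHom_rel (OSRelR.LL_comm (k := k) ℓ.rev ℓ'.rev (flip x)
      (by simp only [Fin.val_rev]; omega) (by rwa [validLR_rev])
      (by rwa [moveLR_rev h1.lt, validLR_rev]))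
    rw [moveLR_rev h1.lt, moveLR_rev h2.lt] at this
    simpa only [map_mul, flipHom_og, flipGen] using this
  | LL_comm ℓ ℓ' x hd h1 h2 =>
    have := RingQuot.mkRingHom_rel (OSRelR.RR_comm (k := k) ℓ.rev ℓ'.rev (flip x)
      (by simp only [Fin.val_rev]; omega) (by rwa [validRR_rev])
      (by rwa [moveRR_rev h1.lt, validRR_rev]))
    rw [moveRR_rev h1.lt, moveRR_rev h2.lt] at this
    simpa only [map_mul, flipHom_og, flipGen] using this
  | LR_comm ℓ ℓ' x hd h1 h2 =>
    obtain ⟨h3, h4, -⟩ := validRL_moveLL_distant hd h1 h2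
    have := RingQuot.mkRingHom_rel (OSRelR.LR_comm (k := k) ℓ'.rev ℓ.rev (flip x)
      (by simp only [Fin.val_rev]; omega) (by rwa [validLR_rev])
      (by rwa [moveLR_rev h3.lt, validRR_rev]))
    rw [moveLR_rev h3.lt, moveRR_rev h1.lt] at this
    simpa only [map_mul, flipHom_og, flipGen] using this.symm
  | RR_zero ℓ ℓ' x h =>
    by_cases hv : ValidRL n k ℓ x
    · have := RingQuot.mkRingHom_rel (OSRelR.LL_zero (k := k) ℓ.rev ℓ'.rev (flip x)
        (by simp only [Fin.val_rev]; omega))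
      rw [moveLR_rev hv.lt] at this
      simpa only [map_mul, map_zero, flipHom_og, flipGen] using this
    · rw [map_mul, map_zero, ← mul_zero (flipHom n (og (OSGen.R ℓ x))), flipHom_og]
      exact mk_mul_eq_of_rel_zero (OSRelR.L_junk _ _ (by rwa [validLR_rev]))
  | LL_zero ℓ ℓ' x h =>
    by_cases hv : ValidLL n k ℓ x
    · have := RingQuot.mkRingHom_rel (OSRelR.RR_zero (k := k) ℓ.rev ℓ'.rev (flip x)
        (by simp only [Fin.val_rev]; omega))
      rw [moveRR_rev hv.lt] at this
      simpa only [map_mul, map_zero, flipHom_og, flipGen] using this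
    · rw [map_mul, map_zero, ← mul_zero (flipHom n (og (OSGen.L ℓ x))), flipHom_og]
      exact mk_mul_eq_of_rel_zero (OSRelR.R_junk _ _ (by rwa [validRR_rev]))
  | U_vanish ℓ x h1 h2 =>
    simpa only [flipHom_og, map_zero, flipGen] using
      RingQuot.mkRingHom_rel (OSRelR.U_vanish (k := k) ℓ.rev (flip x)
        (by rwa [mem_flip, Fin.rev_rev]) (by
        intro h
        have h' := one_le_val_rev.1 h
        rw [prevFin_rev h', mem_flip, Fin.rev_rev]
        exact h2 h'))

lemma mk_flipHom_of_relR ⦃a b : FreeAlgebra ℤ (OSGen n)⦄ (h : OSRelR n k a b) :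
    RingQuot.mkRingHom (OSRelL n k) (flipHom n a) =
      RingQuot.mkRingHom (OSRelL n k) (flipHom n b) := by
  induction h with
  | idem_mul x y =>
    have := RingQuot.mkRingHom_rel (OSRelL.idem_mul (k := k) (flip x) (flip y))
    simp only [flip_injective.eq_iff] at this
    split_ifs at this ⊢ <;> simpa only [map_mul, flipHom_og, map_zero, flipGen] using this
  | idem_sum =>
    have := RingQuot.mkRingHom_rel (OSRelL.idem_sum (n := n) (k := k))
    rw [← sum_flip] at this
    simpa only [map_sum, flipHom_og, map_one, flipGen] using this
  | idem_junk x h =>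
    simpa only [flipHom_og, map_zero, flipGen] using
      RingQuot.mkRingHom_rel (OSRelL.idem_junk (flip x) (by rwa [card_flip]))
  | R_junk ℓ x h =>
    simpa only [flipHom_og, map_zero, flipGen] using
      RingQuot.mkRingHom_rel (OSRelL.L_junk ℓ.rev (flip x) (by rwa [validLL_rev]))
  | L_junk ℓ x h =>
    simpa only [flipHom_og, map_zero, flipGen] using
      RingQuot.mkRingHom_rel (OSRelL.R_junk ℓ.rev (flip x) (by rwa [validRL_rev]))
  | U_junk ℓ x h =>
    simpa only [flipHom_og, map_zero, flipGen] using
      RingQuot.mkRingHom_rel (OSRelL.U_junk ℓ.rev (flip x) (by rwa [card_flip]))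
  | R_src ℓ x =>
    simpa only [map_mul, flipHom_og, flipGen] using
      RingQuot.mkRingHom_rel (OSRelL.L_src (k := k) ℓ.rev (flip x))
  | R_tgt ℓ x =>
    have := RingQuot.mkRingHom_rel (OSRelL.L_tgt (k := k) ℓ.rev (flip x))
    by_cases hv : ValidRR n k ℓ x
    · rw [moveLL_rev hv.2.1] at this
      simpa only [map_mul, flipHom_og, flipGen] using this
    · rw [map_mul, flipHom_og, flipHom_og]
      refine Eq.trans ?_ this
      exact mk_mul_eq_of_rel_zero (OSRelL.L_junk _ _ (by rwa [validLL_rev]))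
  | L_src ℓ x =>
    simpa only [map_mul, flipHom_og, flipGen] using
      RingQuot.mkRingHom_rel (OSRelL.R_src (k := k) ℓ.rev (flip x))
  | L_tgt ℓ x =>
    have := RingQuot.mkRingHom_rel (OSRelL.R_tgt (k := k) ℓ.rev (flip x))
    by_cases hv : ValidLR n k ℓ x
    · rw [moveRL_rev hv.2.1] at this
      simpa only [map_mul, flipHom_og, flipGen] using this
    · rw [map_mul, flipHom_og, flipHom_og]
      refine Eq.trans ?_ this
      exact mk_mul_eq_of_rel_zero (OSRelL.R_junk _ _ (by rwa [validRL_rev]))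
  | U_src ℓ x =>
    simpa only [map_mul, flipHom_og, flipGen] using
      RingQuot.mkRingHom_rel (OSRelL.U_src (k := k) ℓ.rev (flip x))
  | U_tgt ℓ x =>
    simpa only [map_mul, flipHom_og, flipGen] using
      RingQuot.mkRingHom_rel (OSRelL.U_tgt (k := k) ℓ.rev (flip x))
  | U_comm_R j ℓ x =>
    simpa only [map_mul, flipHom_og, flipHom_totUR, flipGen] using
      RingQuot.mkRingHom_rel (OSRelL.U_comm_L (k := k) j.rev ℓ.rev (flip x))
  | U_comm_L j ℓ x =>
    simpa only [map_mul, flipHom_og, flipHom_totUR, flipGen] using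
      RingQuot.mkRingHom_rel (OSRelL.U_comm_R (k := k) j.rev ℓ.rev (flip x))
  | U_comm_U j ℓ x =>
    simpa only [map_mul, flipHom_og, flipHom_totUR, flipGen] using
      RingQuot.mkRingHom_rel (OSRelL.U_comm_U (k := k) j.rev ℓ.rev (flip x))
  | RL_eq_U ℓ x h =>
    have := RingQuot.mkRingHom_rel (OSRelL.LR_eq_U ℓ.rev (flip (moveRR n ℓ x)) (by
      rw [validRL_rev]; exact (validLR_moveRR h).1))
    rw [moveRL_rev h.2.1, (validLR_moveRR h).2] at this
    simpa only [map_mul, flipHom_og, flipGen] using this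
  | LR_eq_U ℓ x h =>
    have := RingQuot.mkRingHom_rel (OSRelL.RL_eq_U ℓ.rev (flip (moveRR n ℓ x)) (by
      rw [validRL_rev]; exact (validLR_moveRR h).1))
    rw [moveRL_rev h.2.1, (validLR_moveRR h).2] at this
    simpa only [map_mul, flipHom_og, flipGen] using this
  | RR_comm ℓ ℓ' x hd h1 h2 =>
    have := RingQuot.mkRingHom_rel (OSRelL.LL_comm (k := k) ℓ.rev ℓ'.rev (flip x)
      (by simp only [Fin.val_rev]; omega) (by rwa [validLL_rev])
      (by rwa [moveLL_rev h1.2.1, validLL_rev]))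
    rw [moveLL_rev h1.2.1, moveLL_rev h2.2.1] at this
    simpa only [map_mul, flipHom_og, flipGen] using this
  | LL_comm ℓ ℓ' x hd h1 h2 =>
    have := RingQuot.mkRingHom_rel (OSRelL.RR_comm (k := k) ℓ.rev ℓ'.rev (flip x)
      (by simp only [Fin.val_rev]; omega) (by rwa [validRL_rev])
      (by rwa [moveRL_rev h1.2.1, validRL_rev]))
    rw [moveRL_rev h1.2.1, moveRL_rev h2.2.1] at this
    simpa only [map_mul, flipHom_og, flipGen] using this
  | LR_comm ℓ ℓ' x hd h1 h2 =>
    obtain ⟨h3, h4⟩ := validRR_moveLR_distant hd h1 h2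
    have := RingQuot.mkRingHom_rel (OSRelL.LR_comm (k := k) ℓ'.rev ℓ.rev (flip x)
      (by simp only [Fin.val_rev]; omega) (by rwa [validLL_rev])
      (by rwa [moveLL_rev h3.2.1, validRL_rev]))
    rw [moveLL_rev h3.2.1, moveRL_rev h1.2.1] at this
    simpa only [map_mul, flipHom_og, flipGen] using this.symm
  | RR_zero ℓ ℓ' x h =>
    by_cases hv : ValidRR n k ℓ x
    · have := RingQuot.mkRingHom_rel (OSRelL.LL_zero (k := k) ℓ.rev ℓ'.rev (flip x)
        (by simp only [Fin.val_rev]; omega))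
      rw [moveLL_rev hv.2.1] at this
      simpa only [map_mul, map_zero, flipHom_og, flipGen] using this
    · rw [map_mul, map_zero, ← mul_zero (flipHom n (og (OSGen.R ℓ x))), flipHom_og]
      exact mk_mul_eq_of_rel_zero (OSRelL.L_junk _ _ (by rwa [validLL_rev]))
  | LL_zero ℓ ℓ' x h =>
    by_cases hv : ValidLR n k ℓ x
    · have := RingQuot.mkRingHom_rel (OSRelL.RR_zero (k := k) ℓ.rev ℓ'.rev (flip x)
        (by simp only [Fin.val_rev]; omega))
      rw [moveRL_rev hv.2.1] at this
      simpa only [map_mul, map_zero, flipHom_og, flipGen] using this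
    · rw [map_mul, map_zero, ← mul_zero (flipHom n (og (OSGen.L ℓ x))), flipHom_og]
      exact mk_mul_eq_of_rel_zero (OSRelL.R_junk _ _ (by rwa [validRL_rev]))
  | U_vanish ℓ x h1 h2 =>
    simpa only [flipHom_og, map_zero, flipGen] using
      RingQuot.mkRingHom_rel (OSRelL.U_vanish (k := k) ℓ.rev (flip x)
        (by rwa [mem_flip, Fin.rev_rev]) (by
          intro h
          have h' := prevFin_rev h
          rw [Fin.rev_rev] at h'
          rw [mem_flip, ← h']
          exact h2 (rev_val_add_one_lt.1 h)))

variable (n k) in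
/-- The reflection from `ℬ_l(n,k)` to `ℬ_r(n,k)`. -/
noncomputable def leftToRight : OSAlgL n k →+* OSAlgR n k :=
  RingQuot.lift ⟨(RingQuot.mkRingHom (OSRelR n k)).comp (flipHom n).toRingHom, mk_flipHom_of_relL⟩

variable (n k) in
/-- The reflection from `ℬ_r(n,k)` to `ℬ_l(n,k)`. -/
noncomputable def rightToLeft : OSAlgR n k →+* OSAlgL n k :=
  RingQuot.lift ⟨(RingQuot.mkRingHom (OSRelL n k)).comp (flipHom n).toRingHom, mk_flipHom_of_relR⟩

lemma leftToRight_mk (a : FreeAlgebra ℤ (OSGen n)) :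
    leftToRight n k (RingQuot.mkRingHom _ a) = RingQuot.mkRingHom _ (flipHom n a) :=
  RingQuot.lift_mkRingHom_apply _ _ _

lemma rightToLeft_mk (a : FreeAlgebra ℤ (OSGen n)) :
    rightToLeft n k (RingQuot.mkRingHom _ a) = RingQuot.mkRingHom _ (flipHom n a) :=
  RingQuot.lift_mkRingHom_apply _ _ _

lemma flipHom_flipHom (a : FreeAlgebra ℤ (OSGen n)) : flipHom n (flipHom n a) = a := by
  suffices (flipHom n).comp (flipHom n) = AlgHom.id ℤ _ from AlgHom.congr_fun this a
  refine FreeAlgebra.hom_ext (funext fun g => ?_)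
  simp only [Function.comp_apply, AlgHom.comp_apply, AlgHom.id_apply]
  rw [flipHom_og, flipHom_og, flipGen_flipGen]

lemma leftToRight_rightToLeft (z : OSAlgR n k) : leftToRight n k (rightToLeft n k z) = z := by
  obtain ⟨a, rfl⟩ := RingQuot.mkRingHom_surjective _ z
  rw [rightToLeft_mk, leftToRight_mk, flipHom_flipHom]

lemma rightToLeft_leftToRight (z : OSAlgL n k) : rightToLeft n k (leftToRight n k z) = z := by
  obtain ⟨a, rfl⟩ := RingQuot.mkRingHom_surjective _ z
  rw [leftToRight_mk, rightToLeft_mk, flipHom_flipHom]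

open MvPolynomial

lemma rename_rev_rename_rev (p : MvPolynomial (Fin n) ℤ) :
    rename Fin.rev (rename Fin.rev p) = p := by
  rw [rename_rename, Fin.rev_involutive.comp_self, rename_id_apply]

lemma rename_rev_mem {p : MvPolynomial (Fin n) ℤ} (hp : p ∈ squarefreeIdeal n k) :
    rename Fin.rev p ∈ squarefreeIdeal n k := by
  suffices squarefreeIdeal n k ≤ (squarefreeIdeal n k).comap (rename Fin.rev : _ →ₐ[ℤ] _) from
    this hp
  refine Ideal.span_le.2 ?_
  rintro _ ⟨S, hS, rfl⟩
  rw [SetLike.mem_coe, Ideal.mem_comap, map_prod]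
  refine Ideal.subset_span ⟨flip S, by rw [card_flip, hS], ?_⟩
  rw [flip, Finset.prod_map]
  simp

theorem center_right (hk : k ≤ n) :
    ∃ φ : MvPolynomial (Fin n) ℤ ⧸ squarefreeIdeal n k →+* OSAlgR n k,
      Function.Injective φ ∧
      Set.range φ = (Subring.center (OSAlgR n k) : Set (OSAlgR n k)) ∧
      ∀ i : Fin n, φ (Ideal.Quotient.mk (squarefreeIdeal n k) (X i)) =
        RingQuot.mkRingHom (OSRelR n k) (totUR n k i) := by
  let ψ : MvPolynomial (Fin n) ℤ →+* OSAlgR n k :=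
    (leftToRight n k).comp ((evalLoop n k).comp (rename Fin.rev : _ →ₐ[ℤ] _).toRingHom)
  have hψ : ∀ p, ψ p = leftToRight n k (evalLoop n k (rename Fin.rev p)) := fun p => rfl
  refine ⟨Ideal.Quotient.lift _ ψ fun p hp => ?_, ?_, ?_, fun i => ?_⟩
  · rw [hψ, evalLoop_eq_zero (rename_rev_mem hp), map_zero]
  · refine RingHom.lift_injective_of_ker_le_ideal _ _ fun p hp => ?_
    rw [RingHom.mem_ker, hψ] at hp
    have h := congrArg (rightToLeft n k) hp
    rw [rightToLeft_leftToRight, map_zero] at h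
    rw [← rename_rev_rename_rev p]
    exact rename_rev_mem (mem_squarefreeIdeal_of_evalLoop hk h)
  · ext z
    constructor
    · rintro ⟨q, rfl⟩
      obtain ⟨p, rfl⟩ := Ideal.Quotient.mk_surjective q
      refine Subring.mem_center_iff.2 fun a => ?_
      rw [Ideal.Quotient.lift_mk, hψ, ← leftToRight_rightToLeft a, ← map_mul, ← map_mul,
        (evalLoop_commute _ _).eq]
    · intro hz
      have hz' := Subring.mem_center_iff.1 hz
      obtain ⟨p, hp⟩ := mem_range_evalLoop (z := rightToLeft n k z)
        (Subring.mem_center_iff.2 fun a => by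
          rw [← rightToLeft_leftToRight a, ← map_mul, hz', map_mul])
      refine ⟨Ideal.Quotient.mk _ (rename Fin.rev p), ?_⟩
      rw [Ideal.Quotient.lift_mk, hψ, rename_rev_rename_rev, hp, leftToRight_rightToLeft]
  · rw [Ideal.Quotient.lift_mk, hψ, rename_X, evalLoop_X, loop, leftToRight_mk, flipHom_totUL,
      Fin.rev_rev]

end Reflection

end OzsvathSzabo

/-- Corollary 6.4: the center of the Ozsváth–Szabó algebra `ℬ_l(n,k)`
(and likewise of `ℬ_r(n,k)`) is isomorphic to
`ℤ[U_1,…,U_n]/(U_{i_1}⋯U_{i_{k+1}} : i_1 < ⋯ < i_{k+1})`, via the ring homomorphism sending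
the class of `U_i` to the central element given by the sum of all the `U_i` loops. -/
theorem center_of_OzsvathSzabo_algebras (n k : ℕ) (hn : 1 ≤ n) (hk : k ≤ n) :
    (∃ φ : MvPolynomial (Fin n) ℤ ⧸ squarefreeIdeal n k →+* OSAlgL n k,
      Function.Injective φ ∧
      Set.range φ = (Subring.center (OSAlgL n k) : Set (OSAlgL n k)) ∧
      ∀ i : Fin n, φ (Ideal.Quotient.mk (squarefreeIdeal n k) (MvPolynomial.X i)) =
        RingQuot.mkRingHom (OSRelL n k) (totUL n k i)) ∧
    (∃ φ : MvPolynomial (Fin n) ℤ ⧸ squarefreeIdeal n k →+* OSAlgR n k,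
      Function.Injective φ ∧
      Set.range φ = (Subring.center (OSAlgR n k) : Set (OSAlgR n k)) ∧
      ∀ i : Fin n, φ (Ideal.Quotient.mk (squarefreeIdeal n k) (MvPolynomial.X i)) =
        RingQuot.mkRingHom (OSRelR n k) (totUR n k i)) := by
  exact ⟨OzsvathSzabo.center_left hk, OzsvathSzabo.center_right hk⟩
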